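/- arXiv:1407.5974 — 3 statements merged into one kernel-verified Lean document; each statement's English description precedes it below -/
import Mathlib

section
/- Let T > 0, let α, γ ∈ (0,1) with α + γ > 1, and fix β ∈ (1−γ, α). Let (X_t)_{t∈[0,T]} be a jointly measurable real-valued stochastic process whose sample paths are almost surely α-Hölder continuous and which satisfies the bounded-density assumption with some nonnegative g ∈ L¹([0,T]), let f : ℝ → ℝ be of locally bounded variation, and let (Y_t)_{t∈[0,T]} be a stochastic process whose sample paths are almost surely γ-Hölder continuous. Let τ : Ω → (0,T] be any random time. Then almost surely the function φ_τ(s) := ( f(X_s) s^{−β} + β ∫₀^s (f(X_s) − f(X_u)) (s−u)^{−1−β} du ) · ( (Y_s − Y_τ)(τ−s)^{−(1−β)} + (1−β) ∫_s^τ (Y_s − Y_u)(u−s)^{−(2−β)} du ) is defined for almost every s ∈ (0,τ) and is Lebesgue integrable on (0,τ); that is, the generalized Lebesgue–Stieltjes integral ∫₀^τ f(X_s) dY_s exists almost surely. -/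
open MeasureTheory Set
open scoped ENNReal

noncomputable section

/-- `x` is `α`-Hölder continuous on `[0,T]`. -/
def HolderOnIcc (α T : ℝ) (x : ℝ → ℝ) : Prop :=
  ∃ C : ℝ, ∀ s ∈ Set.Icc (0:ℝ) T, ∀ t ∈ Set.Icc (0:ℝ) T, |x t - x s| ≤ C * |t - s| ^ α

/-- The bounded-density assumption: for a.e. `t ∈ [0,T]`, the law of `X_t` is bounded above by
`g t` times Lebesgue measure. -/
def BoundedDensityAssumption {Ω : Type*} [MeasurableSpace Ω] (P : Measure Ω)
    (T : ℝ) (X : ℝ → Ω → ℝ) (g : ℝ → ℝ) : Prop :=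
  ∀ᵐ t ∂(volume.restrict (Set.Icc (0:ℝ) T)),
    ∀ A : Set ℝ, MeasurableSet A → P {ω | X t ω ∈ A} ≤ ENNReal.ofReal (g t) * volume A


/-- Clamping to `[-M, M]`. -/
def gCl (M x : ℝ) : ℝ := max (-M) (min M x)

lemma gCl_mono (M : ℝ) : Monotone (gCl M) := fun _ _ h =>
  max_le_max le_rfl (min_le_min le_rfl h)

lemma gCl_cont (M : ℝ) : Continuous (gCl M) := by
  unfold gCl; fun_prop

lemma gCl_eq {M x : ℝ} (h : |x| ≤ M) : gCl M x = x := by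
  rw [abs_le] at h
  unfold gCl
  rw [min_eq_right h.2, max_eq_right h.1]

lemma gCl_hi {M x : ℝ} (hM : 0 ≤ M) (h : M ≤ x) : gCl M x = M := by
  unfold gCl
  rw [min_eq_left h, max_eq_right (by linarith)]

lemma gCl_lo {M x : ℝ} (hM : 0 ≤ M) (h : x ≤ -M) : gCl M x = -M := by
  unfold gCl
  rw [max_eq_left]
  exact (min_le_right _ _).trans h

/-- Increment of the clamped function. -/
def gW (F : ℝ → ℝ) (M h y : ℝ) : ℝ≥0∞ :=
  ENNReal.ofReal (F (gCl M (y + h)) - F (gCl M (y - h)))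

lemma gW_lintegral {F : ℝ → ℝ} (hF : Monotone F) {M h : ℝ} (hM : 0 ≤ M) (hh : 0 ≤ h) :
    ∫⁻ x, gW F M h x ≤ ENNReal.ofReal (2 * h * (F M - F (-M))) := by
  set G : ℝ → ℝ := fun x => F (gCl M x) with hG
  have hGm : Monotone G := hF.comp (gCl_mono M)
  have hGi : ∀ a b, IntervalIntegrable G volume a b := fun a b => hGm.intervalIntegrable
  set R := M + h with hR
  have hR0 : -R ≤ R := by linarith
  have hi1 : IntervalIntegrable (fun x => G (x + h)) volume (-R) R :=
    (hGm.comp (fun a b hab => by simpa using hab : Monotone fun x : ℝ => x + h)).intervalIntegrable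
  have hi2 : IntervalIntegrable (fun x => G (x - h)) volume (-R) R :=
    (hGm.comp (fun a b hab => by simpa using hab : Monotone fun x : ℝ => x - h)).intervalIntegrable
  have hval : ∫ x in (-R)..R, (G (x + h) - G (x - h)) = 2 * h * (F M - F (-M)) := by
    rw [intervalIntegral.integral_sub hi1 hi2, intervalIntegral.integral_comp_add_right,
      intervalIntegral.integral_comp_sub_right,
      intervalIntegral.integral_interval_sub_interval_comm' (hGi _ _) (hGi _ _) (hGi _ _)]
    have e1 : ∫ x in (R - h)..(R + h), G x = ∫ x in (R - h)..(R + h), F M := by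
      apply intervalIntegral.integral_congr
      intro x hx
      rw [uIcc_of_le (by linarith)] at hx
      simp only [hG]
      rw [gCl_hi hM (by linarith [hx.1])]
    have e2 : ∫ x in (-R - h)..(-R + h), G x = ∫ x in (-R - h)..(-R + h), F (-M) := by
      apply intervalIntegral.integral_congr
      intro x hx
      rw [uIcc_of_le (by linarith)] at hx
      simp only [hG]
      rw [gCl_lo hM (by linarith [hx.2])]
    rw [e1, e2]
    simp only [intervalIntegral.integral_const, smul_eq_mul]
    ring
  have hnn : ∀ x, 0 ≤ G (x + h) - G (x - h) := fun x => by
    have := hGm (show x - h ≤ x + h by linarith)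
    linarith
  rw [← hval, intervalIntegral.integral_of_le hR0,
    ofReal_integral_eq_lintegral_ofReal ?_ (Filter.Eventually.of_forall hnn),
    ← lintegral_indicator measurableSet_Ioc]
  · apply lintegral_mono
    intro x
    by_cases hx : x ∈ Ioc (-R) R
    · rw [indicator_of_mem hx]; rfl
    · rw [indicator_of_notMem hx]
      simp only [gW]
      rw [mem_Ioc, not_and_or, not_lt, not_le] at hx
      rcases hx with hx | hx
      · rw [gCl_lo hM (by linarith), gCl_lo hM (by linarith)]; simp
      · rw [gCl_hi hM (by linarith), gCl_hi hM (by linarith)]; simp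
  · exact ((intervalIntegrable_iff_integrableOn_Ioc_of_le hR0).1 (hi1.sub hi2))

lemma gW_meas {F : ℝ → ℝ} (hF : Monotone F) (M : ℝ) :
    Measurable (fun p : ℝ × ℝ => gW F M p.1 p.2) := by
  have h1 : Measurable (fun x => F (gCl M x)) := (hF.comp (gCl_mono M)).measurable
  unfold gW
  exact ((h1.comp (by fun_prop)).sub (h1.comp (by fun_prop))).ennreal_ofReal

lemma gW_expect {Ω : Type*} [MeasurableSpace Ω] (P : Measure Ω) {Z : Ω → ℝ} (hZ : Measurable Z)
    {c : ℝ} (hd : ∀ A : Set ℝ, MeasurableSet A → P {ω | Z ω ∈ A} ≤ ENNReal.ofReal c * volume A)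
    {F : ℝ → ℝ} (hF : Monotone F) {M h : ℝ} (hM : 0 ≤ M) (hh : 0 ≤ h) :
    ∫⁻ ω, gW F M h (Z ω) ∂P ≤ ENNReal.ofReal c * ENNReal.ofReal (2 * h * (F M - F (-M))) := by
  have hm : Measurable (gW F M h) := (gW_meas hF M).comp (measurable_const.prodMk measurable_id)
  rw [← lintegral_map hm hZ]
  have hle : P.map Z ≤ ENNReal.ofReal c • (volume : Measure ℝ) := by
    rw [Measure.le_iff]
    intro A hA
    rw [Measure.map_apply hZ hA]
    exact hd A hA
  calc _ ≤ ∫⁻ x, gW F M h x ∂(ENNReal.ofReal c • (volume : Measure ℝ)) :=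
        lintegral_mono' hle le_rfl
    _ = ENNReal.ofReal c * ∫⁻ x, gW F M h x := by rw [lintegral_smul_measure]; rfl
    _ ≤ _ := by gcongr; exact gW_lintegral hF hM hh

/-- The dominating kernel. -/
def gPhi (F : ℝ → ℝ) (M N α β y s u : ℝ) : ℝ≥0∞ :=
  if 0 < u ∧ u < s then gW F M (N * (s - u) ^ α) y * ENNReal.ofReal ((s - u) ^ (-(1 + β))) else 0

lemma gPhi_meas {F : ℝ → ℝ} (hF : Monotone F) (M N α β : ℝ) :
    Measurable (fun p : ℝ × ℝ × ℝ => gPhi F M N α β p.1 p.2.1 p.2.2) := by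
  unfold gPhi
  refine Measurable.ite ?_ ?_ measurable_const
  · have h1 : MeasurableSet {p : ℝ × ℝ × ℝ | 0 < p.2.2} :=
      measurableSet_lt measurable_const (by fun_prop)
    have h2 : MeasurableSet {p : ℝ × ℝ × ℝ | p.2.2 < p.2.1} :=
      measurableSet_lt (by fun_prop) (by fun_prop)
    exact h1.inter h2
  · have h3 : Measurable fun p : ℝ × ℝ × ℝ =>
        ENNReal.ofReal ((p.2.1 - p.2.2) ^ (-(1 + β))) := by fun_prop
    refine Measurable.mul ?_ h3
    exact (gW_meas hF M).comp
      (f := fun p : ℝ × ℝ × ℝ => (N * (p.2.1 - p.2.2) ^ α, p.1)) (by fun_prop)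

lemma rpow_integrableOn_Ioo {r : ℝ} (hr : -1 < r) (a b : ℝ) :
    IntegrableOn (fun u : ℝ => (u - a) ^ r) (Ioo a b) := by
  rcases le_or_gt b a with h | h
  · simp [Ioo_eq_empty_of_le h]
  have := (intervalIntegral.intervalIntegrable_rpow' (a := 0) (b := b - a) hr).comp_sub_right a
  simp only [zero_add, sub_add_cancel] at this
  exact (((intervalIntegrable_iff_integrableOn_Ioc_of_le h.le).1 this)).mono_set Ioo_subset_Ioc_self

lemma gPhi_ae_fin {Ω : Type*} [MeasurableSpace Ω] (P : Measure Ω) [IsProbabilityMeasure P]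
    (T α β : ℝ) (hβ : β < α)
    (X : ℝ → Ω → ℝ) (hX : Measurable (Function.uncurry X))
    (g : ℝ → ℝ) (hgL1 : IntegrableOn g (Set.Icc 0 T))
    (hdens : BoundedDensityAssumption P T X g)
    {F : ℝ → ℝ} (hF : Monotone F) {M N : ℝ} (hM : 0 ≤ M) (hN : 0 ≤ N) :
    ∀ᵐ ω ∂P, ∫⁻ s in Ioo 0 T, ∫⁻ u, gPhi F M N α β (X s ω) s u < ∞ := by
  have hXm : ∀ s, Measurable (X s) := fun s => hX.comp (measurable_const.prodMk measurable_id)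
  have hm3 : Measurable (fun p : (Ω × ℝ) × ℝ => gPhi F M N α β (X p.1.2 p.1.1) p.1.2 p.2) := by
    have : Measurable (fun p : (Ω × ℝ) × ℝ => X p.1.2 p.1.1) :=
      hX.comp (f := fun p : (Ω × ℝ) × ℝ => (p.1.2, p.1.1)) (by fun_prop)
    exact (gPhi_meas hF M N α β).comp
      (f := fun p : (Ω × ℝ) × ℝ => (X p.1.2 p.1.1, p.1.2, p.2)) (by fun_prop)
  have hm2 : Measurable (fun p : Ω × ℝ => ∫⁻ u, gPhi F M N α β (X p.2 p.1) p.2 u) :=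
    hm3.lintegral_prod_right'
  apply ae_lt_top
  · exact hm2.lintegral_prod_right'
  rw [lintegral_lintegral_swap hm2.aemeasurable]
  set c : ℝ := 2 * N * (F M - F (-M)) with hc
  set d : ℝ → ℝ≥0∞ := (Ioo 0 T).indicator (fun v => ENNReal.ofReal (c * (v - 0) ^ (α - 1 - β)))
    with hd
  have hdfin : ∫⁻ v, d v < ∞ := by
    rw [hd, lintegral_indicator measurableSet_Ioo]
    exact ((rpow_integrableOn_Ioo (r := α - 1 - β) (by linarith) 0 T).const_mul c).lintegral_lt_top
  have hgd : ∫⁻ s in Ioo 0 T, ENNReal.ofReal (g s) * ∫⁻ v, d v < ∞ := by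
    rw [lintegral_mul_const' _ _ hdfin.ne]
    exact ENNReal.mul_lt_top (hgL1.mono_set Ioo_subset_Icc_self).lintegral_lt_top hdfin
  refine ((lintegral_mono_ae ?_).trans_lt hgd).ne
  have hdens' := ae_restrict_of_ae_restrict_of_subset (Ioo_subset_Icc_self) hdens
  filter_upwards [hdens', ae_restrict_mem measurableSet_Ioo] with s hs hsT
  rw [lintegral_lintegral_swap]
  swap
  · refine (hm3.comp (f := fun p : Ω × ℝ => ((p.1, s), p.2)) (by fun_prop)).aemeasurable
  rw [← lintegral_sub_left_eq_self d s, ← lintegral_const_mul']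
  swap
  · exact ENNReal.ofReal_ne_top
  apply lintegral_mono
  intro u
  simp only [gPhi]
  by_cases hu : 0 < u ∧ u < s
  · simp only [hu, and_self, if_true]
    have hsu : 0 < s - u := by linarith [hu.2]
    rw [lintegral_mul_const' _ _ ENNReal.ofReal_ne_top]
    have hmem : s - u ∈ Ioo 0 T := ⟨hsu, by linarith [hu.1, hsT.2]⟩
    rw [hd, indicator_of_mem hmem]
    have hh : 0 ≤ N * (s - u) ^ α := by positivity
    have hcn : 0 ≤ F M - F (-M) := by linarith [hF (show -M ≤ M by linarith)]
    calc _ ≤ ENNReal.ofReal (g s) * ENNReal.ofReal (2 * (N * (s - u) ^ α) * (F M - F (-M)))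
          * ENNReal.ofReal ((s - u) ^ (-(1 + β))) := by
          gcongr; exact gW_expect P (hXm s) hs hF hM hh
      _ = _ := by
          rw [mul_assoc, ← ENNReal.ofReal_mul (by positivity)]
          congr 2
          rw [hc, sub_zero, show α - 1 - β = α + (-(1 + β)) by ring, Real.rpow_add hsu]
          ring
  · simp [hu]

lemma gIncr_le {F : ℝ → ℝ} (hF : Monotone F) {M h a b : ℝ} (ha : |a| ≤ M) (hb : |b| ≤ M)
    (hab : |a - b| ≤ h) : ENNReal.ofReal |F a - F b| ≤ gW F M h a := by
  apply ENNReal.ofReal_le_ofReal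
  rw [abs_le] at hab
  have h1 := hF (gCl_mono M (show b ≤ a + h by linarith))
  have h2 := hF (gCl_mono M (show a - h ≤ b by linarith))
  have h3 := hF (gCl_mono M (show a ≤ a + h by linarith))
  have h4 := hF (gCl_mono M (show a - h ≤ a by linarith))
  rw [gCl_eq hb] at h1 h2
  rw [gCl_eq ha] at h3 h4
  rw [abs_le]
  constructor <;> linarith

/-- The kernel of the left fractional derivative. -/
def gK (f x : ℝ → ℝ) (β : ℝ) (p : ℝ × ℝ) : ℝ :=
  if 0 < p.2 ∧ p.2 < p.1 then (f (x p.1) - f (x p.2)) * (p.1 - p.2) ^ (-(1 + β)) else 0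

lemma gK_meas {f x : ℝ → ℝ} (hf : Measurable f) (hx : Measurable x) (β : ℝ) :
    Measurable (gK f x β) := by
  unfold gK
  refine Measurable.ite ?_ ?_ measurable_const
  · have h1 : MeasurableSet {p : ℝ × ℝ | 0 < p.2} :=
      measurableSet_lt measurable_const (by fun_prop)
    have h2 : MeasurableSet {p : ℝ × ℝ | p.2 < p.1} :=
      measurableSet_lt (by fun_prop) (by fun_prop)
    exact h1.inter h2
  · fun_prop

lemma gK_integrable {p q x : ℝ → ℝ} (hp : Monotone p) (hq : Monotone q) (hx : Measurable x)
    {T α β M N : ℝ} (hb : ∀ s ∈ Icc 0 T, |x s| ≤ M)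
    (hH : ∀ s ∈ Icc 0 T, ∀ t ∈ Icc 0 T, |x t - x s| ≤ N * |t - s| ^ α)
    (hP : ∫⁻ s in Ioo 0 T, ∫⁻ u, gPhi p M N α β (x s) s u < ∞)
    (hQ : ∫⁻ s in Ioo 0 T, ∫⁻ u, gPhi q M N α β (x s) s u < ∞) :
    Integrable (gK (p - q) x β) ((volume.restrict (Ioo 0 T)).prod volume) := by
  have hf : Measurable (p - q) := hp.measurable.sub hq.measurable
  have hk := gK_meas hf hx β
  refine ⟨hk.aestronglyMeasurable, ?_⟩
  rw [hasFiniteIntegral_iff_enorm, lintegral_prod _ hk.enorm.aemeasurable]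
  have hpm : ∀ {F : ℝ → ℝ}, Monotone F →
      Measurable (fun z : ℝ × ℝ => gPhi F M N α β (x z.1) z.1 z.2) := fun {F} hF =>
    (gPhi_meas hF M N α β).comp (f := fun z : ℝ × ℝ => (x z.1, z.1, z.2)) (by fun_prop)
  have hsum : ∫⁻ s in Ioo 0 T, ∫⁻ u, (gPhi p M N α β (x s) s u + gPhi q M N α β (x s) s u) < ∞ := by
    have e : ∀ s, ∫⁻ u, (gPhi p M N α β (x s) s u + gPhi q M N α β (x s) s u)
        = (∫⁻ u, gPhi p M N α β (x s) s u) + ∫⁻ u, gPhi q M N α β (x s) s u := fun s => by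
      have hms : Measurable (fun u => gPhi p M N α β (x s) s u) :=
        (hpm hp).comp (measurable_const.prodMk measurable_id)
      exact lintegral_add_left hms _
    simp_rw [e]
    rw [lintegral_add_left (hpm hp).lintegral_prod_right']
    exact ENNReal.add_lt_top.2 ⟨hP, hQ⟩
  refine lt_of_le_of_lt (lintegral_mono_ae ?_) hsum
  filter_upwards [ae_restrict_mem measurableSet_Ioo] with s hs
  apply lintegral_mono
  intro u
  simp only [gK, gPhi]
  by_cases hu : 0 < u ∧ u < s
  · simp only [hu, and_self, if_true]
    have hsu : 0 < s - u := by linarith [hu.2]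
    have hsI : s ∈ Icc 0 T := Ioo_subset_Icc_self hs
    have huI : u ∈ Icc 0 T := ⟨hu.1.le, by linarith [hs.2]⟩
    have hh := hH u huI s hsI
    rw [abs_of_pos hsu] at hh
    rw [enorm_mul, ← add_mul, Real.enorm_eq_ofReal_abs ((s - u) ^ (-(1 + β))),
      abs_of_pos (Real.rpow_pos_of_pos hsu _)]
    gcongr
    rw [Real.enorm_eq_ofReal_abs]
    have h1 := gIncr_le hp (hb s hsI) (hb u huI) hh
    have h2 := gIncr_le hq (hb s hsI) (hb u huI) hh
    refine le_trans ?_ (add_le_add h1 h2)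
    rw [← ENNReal.ofReal_add (abs_nonneg _) (abs_nonneg _)]
    apply ENNReal.ofReal_le_ofReal
    simp only [Pi.sub_apply]
    have := abs_sub (p (x s) - p (x u)) (q (x s) - q (x u))
    refine le_trans (le_of_eq ?_) this
    congr 1; ring
  · simp [hu]

lemma gK_slice (f x : ℝ → ℝ) (β s : ℝ) :
    (fun u => gK f x β (s, u)) = (Ioo 0 s).indicator
      (fun u => (f (x s) - f (x u)) * (s - u) ^ (-(1 + β))) := by
  ext u
  by_cases hu : 0 < u ∧ u < s
  · rw [indicator_of_mem (show u ∈ Ioo 0 s from hu)]; simp [gK, hu]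
  · rw [indicator_of_notMem (show u ∉ Ioo 0 s from hu)]; simp [gK, hu]

/-- The first factor. -/
lemma gFirst {p q x : ℝ → ℝ} (hp : Monotone p) (hq : Monotone q) (hx : Measurable x)
    {T α β M N : ℝ} (hβ1 : β < 1) (hb : ∀ s ∈ Icc 0 T, |x s| ≤ M)
    (hH : ∀ s ∈ Icc 0 T, ∀ t ∈ Icc 0 T, |x t - x s| ≤ N * |t - s| ^ α)
    (hP : ∫⁻ s in Ioo 0 T, ∫⁻ u, gPhi p M N α β (x s) s u < ∞)
    (hQ : ∫⁻ s in Ioo 0 T, ∫⁻ u, gPhi q M N α β (x s) s u < ∞) :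
    (∀ᵐ s ∂(volume.restrict (Ioo (0:ℝ) T)),
        IntegrableOn (fun u => ((p - q) (x s) - (p - q) (x u)) * (s - u) ^ (-(1 + β)))
          (Ioo (0:ℝ) s)) ∧
    IntegrableOn (fun s => ((p - q) (x s) * s ^ (-β) +
            β * ∫ u in Ioo (0:ℝ) s,
              ((p - q) (x s) - (p - q) (x u)) * (s - u) ^ (-(1 + β)))) (Ioo 0 T) := by
  have hI := gK_integrable hp hq hx hb hH hP hQ
  have hf : Measurable (p - q) := hp.measurable.sub hq.measurable
  constructor
  · filter_upwards [hI.prod_right_ae] with s hs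
    rw [gK_slice, integrable_indicator_iff measurableSet_Ioo] at hs
    exact hs
  · refine Integrable.add ?_ (Integrable.const_mul ?_ β)
    · have h1 := rpow_integrableOn_Ioo (r := -β) (by linarith) 0 T
      simp only [sub_zero] at h1
      refine Integrable.bdd_mul (c := |p M| + |p (-M)| + |q M| + |q (-M)|) h1
        (hf.comp hx).aestronglyMeasurable ?_
      filter_upwards [ae_restrict_mem measurableSet_Ioo] with s hs
      have hxs := abs_le.1 (hb s (Ioo_subset_Icc_self hs))
      have a1 := hp hxs.1
      have a2 := hp hxs.2
      have a3 := hq hxs.1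
      have a4 := hq hxs.2
      simp only [Pi.sub_apply, Real.norm_eq_abs]
      rw [abs_le]
      constructor <;>
      linarith [le_abs_self (p M), neg_abs_le (p M), le_abs_self (p (-M)), neg_abs_le (p (-M)),
        le_abs_self (q M), neg_abs_le (q M), le_abs_self (q (-M)), neg_abs_le (q (-M))]
    · have := hI.integral_prod_left
      refine this.congr (Filter.Eventually.of_forall fun s => ?_)
      simp only [gK_slice]
      rw [integral_indicator measurableSet_Ioo]

lemma rpow_setIntegral_le {r : ℝ} (hr : -1 < r) {a b T : ℝ} (hab : a ≤ b) (hT : b - a ≤ T) :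
    ∫ u in Ioo a b, (u - a) ^ r ≤ T ^ (r + 1) / (r + 1) := by
  rw [← integral_Ioc_eq_integral_Ioo, ← intervalIntegral.integral_of_le hab,
    intervalIntegral.integral_comp_sub_right (fun v => v ^ r), sub_self, integral_rpow (Or.inl hr),
    Real.zero_rpow (by linarith), sub_zero]
  have : 0 ≤ r + 1 := by linarith
  have h2 : 0 ≤ b - a := by linarith
  gcongr

/-- The second factor. -/
lemma gSecond {y : ℝ → ℝ} {T γ β τ : ℝ} (hγ : 0 < γ) (hγβ : 1 - γ < β) (hβ1 : β < 1)
    (hy : HolderOnIcc γ T y) (hτ : τ ∈ Ioc 0 T) :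
    (∀ s ∈ Ioo 0 τ, IntegrableOn (fun u => (y s - y u) * (u - s) ^ (-(2 - β))) (Ioo s τ)) ∧
    AEStronglyMeasurable (fun s => (y s - y τ) * (τ - s) ^ (-(1 - β)) +
            (1 - β) * ∫ u in Ioo s τ, (y s - y u) * (u - s) ^ (-(2 - β)))
            (volume.restrict (Ioo 0 τ)) ∧
    ∃ c : ℝ, ∀ s ∈ Ioo 0 τ, ‖(y s - y τ) * (τ - s) ^ (-(1 - β)) +
            (1 - β) * ∫ u in Ioo s τ, (y s - y u) * (u - s) ^ (-(2 - β))‖ ≤ c := by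
  obtain ⟨C₀, hC₀⟩ := hy
  set C := |C₀| with hCdef
  have hC : ∀ s ∈ Icc 0 T, ∀ t ∈ Icc 0 T, |y s - y t| ≤ C * |s - t| ^ γ := by
    intro s hs t ht
    refine (hC₀ t ht s hs).trans ?_
    gcongr
    exact le_abs_self _
  have hT : 0 ≤ T := hτ.1.le.trans hτ.2
  have hC0 : 0 ≤ C := abs_nonneg _
  have hyc : ContinuousOn y (Icc 0 T) := by
    intro s hs
    rw [ContinuousWithinAt, tendsto_iff_norm_sub_tendsto_zero]
    have h0 : Filter.Tendsto (fun t => C * |t - s| ^ γ) (nhdsWithin s (Icc 0 T)) (nhds 0) := by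
      have : Continuous (fun t : ℝ => C * |t - s| ^ γ) := by
        refine continuous_const.mul (Continuous.rpow_const (by fun_prop) (fun _ => Or.inr hγ.le))
      have h := (this.tendsto s).mono_left (nhdsWithin_le_nhds (s := Icc 0 T))
      simpa [Real.zero_rpow hγ.ne'] using h
    refine squeeze_zero' (Filter.Eventually.of_forall fun _ => norm_nonneg _) ?_ h0
    filter_upwards [self_mem_nhdsWithin] with t ht
    exact hC t ht s hs
  set z : ℝ → ℝ := (Icc 0 T).piecewise y (fun _ => 0) with hz
  have hzm : Measurable z := by
    classical
    exact hyc.measurable_piecewise continuousOn_const measurableSet_Icc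
  have hzy : ∀ s ∈ Icc 0 T, z s = y s := fun s hs => by
    rw [hz, piecewise_eq_of_mem _ _ _ hs]
  have hbd : ∀ s ∈ Ioo 0 τ, ∀ u ∈ Ioo s τ,
      ‖(y s - y u) * (u - s) ^ (-(2 - β))‖ ≤ C * (u - s) ^ (γ + β - 2) := by
    intro s hs u hu
    have hus : 0 < u - s := by linarith [hu.1]
    have h1 := hC s ⟨hs.1.le, hs.2.le.trans hτ.2⟩ u ⟨(hs.1.trans hu.1).le, hu.2.le.trans hτ.2⟩
    rw [abs_sub_comm s u, abs_of_pos hus] at h1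
    rw [norm_mul, Real.norm_eq_abs, Real.norm_eq_abs, abs_of_pos (Real.rpow_pos_of_pos hus _),
      show γ + β - 2 = γ + (-(2 - β)) by ring, Real.rpow_add hus, ← mul_assoc]
    gcongr
  have hint : ∀ s ∈ Ioo 0 τ, IntegrableOn (fun u => C * (u - s) ^ (γ + β - 2)) (Ioo s τ) :=
    fun s _ => (rpow_integrableOn_Ioo (by linarith) s τ).const_mul C
  refine ⟨?_, ?_, ?_⟩
  · intro s hs
    refine Integrable.mono' (hint s hs) ?_ ?_
    · have : Measurable (fun u => (y s - z u) * (u - s) ^ (-(2 - β))) := by fun_prop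
      refine this.aestronglyMeasurable.congr ?_
      filter_upwards [ae_restrict_mem measurableSet_Ioo] with u hu
      rw [hzy u ⟨(hs.1.trans hu.1).le, hu.2.le.trans hτ.2⟩]
    · filter_upwards [ae_restrict_mem measurableSet_Ioo] with u hu
      exact hbd s hs u hu
  · set k : ℝ × ℝ → ℝ := fun p => if p.1 < p.2 ∧ p.2 < τ then
      (z p.1 - z p.2) * (p.2 - p.1) ^ (-(2 - β)) else 0 with hk
    have hkm : Measurable k := by
      refine Measurable.ite ?_ ?_ measurable_const
      · have h1 : MeasurableSet {p : ℝ × ℝ | p.1 < p.2} :=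
          measurableSet_lt (by fun_prop) (by fun_prop)
        have h2 : MeasurableSet {p : ℝ × ℝ | p.2 < τ} :=
          measurableSet_lt (by fun_prop) (by fun_prop)
        exact h1.inter h2
      · fun_prop
    have hkint : StronglyMeasurable (fun s => ∫ u, k (s, u)) :=
      hkm.stronglyMeasurable.integral_prod_right'
    have hm : Measurable (fun s => (z s - y τ) * (τ - s) ^ (-(1 - β)) +
        (1 - β) * ∫ u, k (s, u)) := by
      have := hkint.measurable
      fun_prop
    refine hm.aestronglyMeasurable.congr ?_
    filter_upwards [ae_restrict_mem measurableSet_Ioo] with s hs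
    have hsI : s ∈ Icc 0 T := ⟨hs.1.le, hs.2.le.trans hτ.2⟩
    rw [hzy s hsI, ← integral_indicator measurableSet_Ioo]
    congr 3
    ext u
    by_cases hu : s < u ∧ u < τ
    · rw [indicator_of_mem (show u ∈ Ioo s τ from hu)]
      simp only [hk, hu, and_self, if_true]
      rw [hzy s hsI, hzy u ⟨(hs.1.trans hu.1).le, hu.2.le.trans hτ.2⟩]
    · rw [indicator_of_notMem (show u ∉ Ioo s τ from hu)]
      simp [hk, hu]
  · refine ⟨C * T ^ (γ + β - 1) + (1 - β) * (C * (T ^ (γ + β - 2 + 1) / (γ + β - 2 + 1))), ?_⟩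
    intro s hs
    have hτs : 0 < τ - s := by linarith [hs.2]
    have hτs' : τ - s ≤ T := by linarith [hs.1, hτ.2]
    have h1β : 0 ≤ 1 - β := by linarith
    refine (norm_add_le _ _).trans (add_le_add ?_ ?_)
    · have h1 := hC s ⟨hs.1.le, hs.2.le.trans hτ.2⟩ τ ⟨hτ.1.le, hτ.2⟩
      rw [abs_sub_comm s τ, abs_of_pos hτs] at h1
      rw [norm_mul, Real.norm_eq_abs, Real.norm_eq_abs, abs_of_pos (Real.rpow_pos_of_pos hτs _)]
      calc _ ≤ C * (τ - s) ^ γ * (τ - s) ^ (-(1 - β)) := by gcongr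
        _ = C * (τ - s) ^ (γ + β - 1) := by
          rw [show γ + β - 1 = γ + (-(1 - β)) by ring, Real.rpow_add hτs, ← mul_assoc]
        _ ≤ _ := by
          have : 0 ≤ γ + β - 1 := by linarith
          gcongr
    · rw [norm_mul, Real.norm_eq_abs, abs_of_nonneg h1β]
      gcongr
      calc _ ≤ ∫ u in Ioo s τ, C * (u - s) ^ (γ + β - 2) := by
            refine norm_integral_le_of_norm_le (hint s hs) ?_
            filter_upwards [ae_restrict_mem measurableSet_Ioo] with u hu
            exact hbd s hs u hu
        _ = C * ∫ u in Ioo s τ, (u - s) ^ (γ + β - 2) := integral_const_mul _ _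
        _ ≤ _ := by
            gcongr
            exact rpow_setIntegral_le (by linarith) hs.2.le hτs'

/-- existence of the generalized Lebesgue–Stieltjes integral `∫₀^τ f(X_s) dY_s`
over a random interval `(0,τ]`, `τ : Ω → (0,T]` a random time: almost surely, the Weyl
fractional derivatives are defined for a.e. `s ∈ (0,τ)` and their product `φ_τ` is Lebesgue
integrable on `(0,τ)`. -/
theorem gLS_integral_exists_random_time
    {Ω : Type*} [MeasurableSpace Ω] (P : Measure Ω) [IsProbabilityMeasure P]
    (T α γ β : ℝ) (hT : 0 < T) (hα : α ∈ Set.Ioo (0:ℝ) 1) (hγ : γ ∈ Set.Ioo (0:ℝ) 1)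
    (hαγ : 1 < α + γ) (hβ : β ∈ Set.Ioo (1 - γ) α)
    (X : ℝ → Ω → ℝ) (hX : Measurable (Function.uncurry X))
    (hXHolder : ∀ᵐ ω ∂P, HolderOnIcc α T (fun t => X t ω))
    (g : ℝ → ℝ) (hg0 : ∀ t, 0 ≤ g t) (hgL1 : IntegrableOn g (Set.Icc 0 T))
    (hdens : BoundedDensityAssumption P T X g)
    (f : ℝ → ℝ) (hf : LocallyBoundedVariationOn f Set.univ)
    (Y : ℝ → Ω → ℝ) (hYHolder : ∀ᵐ ω ∂P, HolderOnIcc γ T (fun t => Y t ω))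
    (τ : Ω → ℝ) (hτmeas : Measurable τ) (hτ : ∀ ω, τ ω ∈ Set.Ioc (0:ℝ) T) :
    ∀ᵐ ω ∂P,
      (∀ᵐ s ∂(volume.restrict (Set.Ioo (0:ℝ) (τ ω))),
        IntegrableOn (fun u => (f (X s ω) - f (X u ω)) * (s - u) ^ (-(1 + β)))
          (Set.Ioo (0:ℝ) s) ∧
        IntegrableOn (fun u => (Y s ω - Y u ω) * (u - s) ^ (-(2 - β))) (Set.Ioo s (τ ω))) ∧
      IntegrableOn (fun s =>
          (f (X s ω) * s ^ (-β) +
            β * ∫ u in Set.Ioo (0:ℝ) s, (f (X s ω) - f (X u ω)) * (s - u) ^ (-(1 + β))) *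
          ((Y s ω - Y (τ ω) ω) * (τ ω - s) ^ (-(1 - β)) +
            (1 - β) * ∫ u in Set.Ioo s (τ ω), (Y s ω - Y u ω) * (u - s) ^ (-(2 - β))))
        (Set.Ioo (0:ℝ) (τ ω)) := by
  obtain ⟨p, q, hp', hq', rfl⟩ := hf.exists_monotoneOn_sub_monotoneOn
  have hp : Monotone p := monotoneOn_univ.1 hp'
  have hq : Monotone q := monotoneOn_univ.1 hq'
  have hβ1 : β < 1 := hβ.2.trans hα.2
  have hfin : ∀ F : ℝ → ℝ, Monotone F → ∀ᵐ ω ∂P, ∀ M N : ℕ,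
      ∫⁻ s in Ioo 0 T, ∫⁻ u, gPhi F M N α β (X s ω) s u < ∞ := by
    intro F hF
    rw [ae_all_iff]; intro M
    rw [ae_all_iff]; intro N
    exact gPhi_ae_fin P T α β hβ.2 X hX g hgL1 hdens hF (Nat.cast_nonneg _) (Nat.cast_nonneg _)
  filter_upwards [hXHolder, hYHolder, hfin p hp, hfin q hq] with ω hXω hYω hPω hQω
  obtain ⟨C, hC⟩ := hXω
  obtain ⟨N, hN⟩ := exists_nat_ge C
  obtain ⟨M, hM⟩ := exists_nat_ge (|X 0 ω| + N * T ^ α)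
  have hH : ∀ s ∈ Icc 0 T, ∀ t ∈ Icc 0 T, |X t ω - X s ω| ≤ N * |t - s| ^ α := by
    intro s hs t ht
    refine (hC s hs t ht).trans ?_
    gcongr
  have hb : ∀ s ∈ Icc 0 T, |X s ω| ≤ M := by
    intro s hs
    have h := hH 0 ⟨le_rfl, hT.le⟩ s hs
    rw [sub_zero, abs_of_nonneg hs.1] at h
    have h2 : (N : ℝ) * s ^ α ≤ N * T ^ α := by
      have := hα.1.le
      have := hs.1
      gcongr
      exact hs.2
    have h3 := abs_sub_abs_le_abs_sub (X s ω) (X 0 ω)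
    linarith
  have hxm : Measurable (fun t => X t ω) := hX.comp (measurable_id.prodMk measurable_const)
  obtain ⟨hA, hB⟩ := gFirst (x := fun t => X t ω) hp hq hxm hβ1 hb hH (hPω M N) (hQω M N)
  obtain ⟨hD, hE, c, hc⟩ := gSecond hγ.1 hβ.1 hβ1 hYω (hτ ω)
  have hsub : Ioo 0 (τ ω) ⊆ Ioo 0 T := Ioo_subset_Ioo_right (hτ ω).2
  refine ⟨?_, ?_⟩
  · filter_upwards [ae_restrict_of_ae_restrict_of_subset hsub hA,
      ae_restrict_mem measurableSet_Ioo] with s h1 h2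
    exact ⟨h1, hD s h2⟩
  · refine Integrable.mul_bdd (c := c) (hB.mono_set hsub) hE ?_
    filter_upwards [ae_restrict_mem measurableSet_Ioo] with s hs
    exact hc s hs

end
end

section
/- Let T > 0 and let α, γ ∈ (0,1) with α + γ > 1. Let (X_t)_{t∈[0,T]} be a jointly measurable real-valued stochastic process whose sample paths are almost surely α-Hölder continuous and which satisfies the bounded-density assumption with some nonnegative g ∈ L¹([0,T]); let h : ℝ → ℝ be left-continuous and of locally bounded variation; and let (Y_t)_{t∈[0,T]} be a stochastic process whose sample paths are almost surely γ-Hölder continuous. Then there exists a random variable I such that for every sequence (π_n) of tagged partitions of [0,T] with mesh |π_n| → 0, the Riemann–Stieltjes sums Σ_{i=1}^{k(n)} h(X_{τ_i^n}) (Y_{t_i^n} − Y_{t_{i−1}^n}) converge almost surely to I as n → ∞. -/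
open MeasureTheory Set Filter
open scoped ENNReal

noncomputable section

/-- A tagged partition `0 = t_0 < t_1 < … < t_k = T` of `[0,T]` with tags
`τ_i ∈ [t_{i-1}, t_i]`. -/
structure TaggedPartition (T : ℝ) where
  k : ℕ
  hk : 0 < k
  t : ℕ → ℝ
  tag : ℕ → ℝ
  h0 : t 0 = 0
  hT : t k = T
  mono : ∀ i, i < k → t i < t (i + 1)
  tagmem : ∀ i, i < k → tag i ∈ Set.Icc (t i) (t (i + 1))

/-- The mesh `|π| = max_i (t_i - t_{i-1})` of a tagged partition. -/
def TaggedPartition.mesh {T : ℝ} (π : TaggedPartition T) : ℝ :=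
  (Finset.range π.k).sup' (Finset.nonempty_range_iff.mpr π.hk.ne')
    (fun i => π.t (i + 1) - π.t i)

/-- The Riemann–Stieltjes sum `Σ_i Z(τ_i) (Y(t_i) - Y(t_{i-1}))` along a tagged partition. -/
def TaggedPartition.rsSum {T : ℝ} (π : TaggedPartition T) (Z Y : ℝ → ℝ) : ℝ :=
  ∑ i ∈ Finset.range π.k, Z (π.tag i) * (Y (π.t (i + 1)) - Y (π.t i))

namespace TaggedPartition

variable {T : ℝ}

lemma step_le_mesh (π : TaggedPartition T) {i : ℕ} (hi : i < π.k) :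
    π.t (i + 1) - π.t i ≤ π.mesh :=
  Finset.le_sup' (fun i => π.t (i + 1) - π.t i) (Finset.mem_range.2 hi)

lemma t_le (π : TaggedPartition T) {i j : ℕ} (hij : i ≤ j) (hj : j ≤ π.k) : π.t i ≤ π.t j := by
  induction j, hij using Nat.le_induction with
  | base => exact le_rfl
  | succ n hn ih => exact (ih (by omega)).trans (π.mono n (by omega)).le

lemma t_mem (π : TaggedPartition T) {i : ℕ} (hi : i ≤ π.k) : π.t i ∈ Icc (0:ℝ) T := by
  constructor
  · rw [← π.h0]; exact π.t_le (Nat.zero_le _) hi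
  · conv_rhs => rw [← π.hT]
    exact π.t_le hi le_rfl

lemma tag_mem (π : TaggedPartition T) {i : ℕ} (hi : i < π.k) : π.tag i ∈ Icc (0:ℝ) T :=
  ⟨(π.t_mem hi.le).1.trans (π.tagmem i hi).1, (π.tagmem i hi).2.trans (π.t_mem (i := i+1) hi).2⟩

lemma tag_le (π : TaggedPartition T) {i j : ℕ} (hij : i ≤ j) (hj : j < π.k) :
    π.tag i ≤ π.tag j := by
  rcases hij.eq_or_lt with rfl | h
  · exact le_rfl
  · exact ((π.tagmem i (by omega)).2.trans (π.t_le (i := i+1) h hj.le)).trans (π.tagmem j hj).1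

/-- Riemann sums of an indicator of a half line. -/
lemma rsSum_indicator (π : TaggedPartition T) (a : ℝ) (ha : a ∈ Icc (0:ℝ) T) (v : ℝ → ℝ) :
    ∃ p ∈ Icc (0:ℝ) T, |p - a| ≤ π.mesh ∧
      π.rsSum (fun t => if a ≤ t then 1 else 0) v = v T - v p := by
  have key : ∀ n ≤ π.k, ∃ q ≤ n, (∑ i ∈ Finset.range n,
      (if a ≤ π.tag i then (1:ℝ) else 0) * (v (π.t (i + 1)) - v (π.t i)) = v (π.t n) - v (π.t q)) ∧
      (∀ i < q, π.tag i < a) ∧ (q < n → a ≤ π.tag q) := by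
    intro n
    induction n with
    | zero => intro _; exact ⟨0, le_rfl, by simp, by simp, by simp⟩
    | succ n ih =>
      intro hn
      obtain ⟨q, hq, hs, h1, h2⟩ := ih (by omega)
      by_cases hc : a ≤ π.tag n
      · refine ⟨q, by omega, ?_, h1, ?_⟩
        · rw [Finset.sum_range_succ, hs, if_pos hc]; ring
        · intro _
          rcases hq.eq_or_lt with rfl | h
          · exact hc
          · exact h2 h
      · have : q = n := by
          by_contra hne
          have hlt : q < n := by omega
          exact hc ((h2 hlt).trans (π.tag_le hlt.le (by omega)))
        subst this
        refine ⟨q + 1, le_rfl, ?_, ?_, by simp⟩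
        · rw [Finset.sum_range_succ, hs, if_neg hc]; ring
        · intro i hi
          rcases Nat.lt_succ_iff_lt_or_eq.1 hi with h | rfl
          · exact h1 i h
          · exact not_le.1 hc
  obtain ⟨q, hq, hs, h1, h2⟩ := key π.k le_rfl
  have hm : 0 ≤ π.mesh := by
    have := π.step_le_mesh π.hk
    have := π.mono 0 π.hk
    linarith
  refine ⟨π.t q, π.t_mem hq, ?_, ?_⟩
  · rw [abs_le]
    constructor
    · rcases hq.eq_or_lt with rfl | h
      · rw [π.hT]; linarith [ha.2]
      · have := π.step_le_mesh h
        have := (π.tagmem q h).2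
        linarith [h2 h]
    · cases q with
      | zero => rw [π.h0]; linarith [ha.1]
      | succ q =>
        have := π.step_le_mesh (i := q) (by omega)
        have := (π.tagmem q (by omega)).1
        linarith [h1 q (by omega)]
  · rw [π.hT] at hs
    exact hs

lemma rsSum_add_right (π : TaggedPartition T) (z v w : ℝ → ℝ) :
    π.rsSum z (fun t => v t + w t) = π.rsSum z v + π.rsSum z w := by
  unfold rsSum
  rw [← Finset.sum_add_distrib]
  exact Finset.sum_congr rfl fun i _ => by ring

lemma rsSum_sub_right (π : TaggedPartition T) (z v w : ℝ → ℝ) :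
    π.rsSum z (fun t => v t - w t) = π.rsSum z v - π.rsSum z w := by
  unfold rsSum
  rw [← Finset.sum_sub_distrib]
  exact Finset.sum_congr rfl fun i _ => by ring

/-- truncated lengths of intervals tagged in `[a,b]` -/
lemma sum_min_le (π : TaggedPartition T) (a b ρ : ℝ) (hab : a ≤ b) (hρ : 0 ≤ ρ) :
    ∑ i ∈ Finset.range π.k, (if π.tag i ∈ Icc a b then min (π.t (i+1) - π.t i) ρ else 0)
      ≤ (b - a) + 2 * ρ := by
  have h1 : ∀ i ∈ Finset.range π.k,
      (if π.tag i ∈ Icc a b then min (π.t (i+1) - π.t i) ρ else 0) ≤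
      max (a - ρ) (min (π.t (i+1)) (b + ρ)) - max (a - ρ) (min (π.t i) (b + ρ)) := by
    intro i hi
    have hi' := Finset.mem_range.1 hi
    have hm := π.mono i hi'
    obtain ⟨ht1, ht2⟩ := π.tagmem i hi'
    split_ifs with hc
    · obtain ⟨hc1, hc2⟩ := hc
      have e1 : min (π.t i) (b + ρ) = π.t i := min_eq_left (by linarith)
      have e2 : max (a - ρ) (min (π.t (i+1)) (b + ρ)) = min (π.t (i+1)) (b + ρ) :=
        max_eq_right (le_min (by linarith) (by linarith))
      rw [e1, e2]
      rcases le_total (π.t (i+1)) (b + ρ) with h3 | h3 <;>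
      rcases le_total (a - ρ) (π.t i) with h4 | h4 <;>
      rcases le_total (π.t (i+1) - π.t i) ρ with h5 | h5 <;>
      simp only [min_eq_left, min_eq_right, max_eq_left, max_eq_right, h3, h4, h5] <;> linarith
    · have : max (a - ρ) (min (π.t i) (b + ρ)) ≤ max (a - ρ) (min (π.t (i+1)) (b + ρ)) :=
        max_le_max le_rfl (min_le_min hm.le le_rfl)
      linarith
  refine (Finset.sum_le_sum h1).trans ?_
  rw [Finset.sum_range_sub (fun i => max (a - ρ) (min (π.t i) (b + ρ)))]
  have : max (a - ρ) (min (π.t π.k) (b + ρ)) ≤ b + ρ := max_le (by linarith) (min_le_right _ _)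
  have : a - ρ ≤ max (a - ρ) (min (π.t 0) (b + ρ)) := le_max_left _ _
  linarith

end TaggedPartition

/-- step function approximation of `z` on the grid `jε`, `j ≤ n`. -/
def stepFn (z : ℝ → ℝ) (ε : ℝ) (n : ℕ) (t : ℝ) : ℝ :=
  z 0 + ∑ j ∈ Finset.range n, (z ((j + 1 : ℕ) * ε) - z (j * ε)) * (if ((j+1 : ℕ) * ε) ≤ t then 1 else 0)

lemma stepFn_eq (z : ℝ → ℝ) (ε : ℝ) (hε : 0 < ε) (n : ℕ) (t : ℝ)
    (ht : t ∈ Icc 0 (((n:ℕ)+1) * ε)) :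
    ∃ j ≤ n, t ∈ Icc (j * ε) ((j + 1) * ε) ∧ stepFn z ε n t = z (j * ε) := by
  induction n with
  | zero => exact ⟨0, le_rfl, by simpa using ht, by simp [stepFn]⟩
  | succ n ih =>
    by_cases hc : ((n+1 : ℕ) * ε) ≤ t
    · refine ⟨n+1, le_rfl, ⟨hc, ht.2⟩, ?_⟩
      unfold stepFn
      have : ∀ j ∈ Finset.range (n+1), (z ((j + 1 : ℕ) * ε) - z (j * ε)) *
          (if ((j+1 : ℕ) * ε) ≤ t then (1:ℝ) else 0) = z ((j + 1 : ℕ) * ε) - z (j * ε) := by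
        intro j hj
        rw [if_pos, mul_one]
        refine le_trans ?_ hc
        gcongr
        have := Finset.mem_range.1 hj
        omega
      rw [Finset.sum_congr rfl this, Finset.sum_range_sub (fun j : ℕ => z (j * ε))]
      simp
    · obtain ⟨j, hj, hjt, he⟩ := ih ⟨ht.1, by push_cast at hc; exact (not_le.1 hc).le⟩
      refine ⟨j, by omega, hjt, ?_⟩
      rw [← he]
      unfold stepFn
      rw [Finset.sum_range_succ, if_neg hc]
      ring

lemma rsSum_stepFn {T : ℝ} (π : TaggedPartition T) (z v : ℝ → ℝ) (ε : ℝ) (n : ℕ) :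
    π.rsSum (stepFn z ε n) v = z 0 * (v T - v 0) + ∑ j ∈ Finset.range n,
      (z ((j + 1 : ℕ) * ε) - z (j * ε)) *
        π.rsSum (fun t => if ((j+1 : ℕ) * ε) ≤ t then 1 else 0) v := by
  unfold TaggedPartition.rsSum stepFn
  simp_rw [add_mul, Finset.sum_add_distrib, Finset.mul_sum, Finset.sum_mul]
  congr 1
  · rw [← Finset.mul_sum, Finset.sum_range_sub (fun i => v (π.t i)), π.hT, π.h0]
  · rw [Finset.sum_comm]
    exact Finset.sum_congr rfl fun j _ => Finset.sum_congr rfl fun i _ => by ring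

/-- `o j` bounds the oscillation of `z` on the `j`-th cell. -/
def OscBound (z : ℝ → ℝ) (ε : ℝ) (n : ℕ) (o : ℕ → ℝ) : Prop :=
  ∀ j ≤ n, 0 ≤ o j ∧ ∀ s ∈ Icc (j * ε) ((j + 1) * ε), ∀ t ∈ Icc (j * ε) ((j + 1) * ε),
    |z s - z t| ≤ o j

lemma rsSum_stepFn_le {T : ℝ} (π : TaggedPartition T) (z v : ℝ → ℝ) (ε : ℝ) (hε : 0 < ε) (n : ℕ)
    (hn : ((n:ℕ) + 1) * ε = T) (o : ℕ → ℝ) (ho : OscBound z ε n o) (B : ℝ)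
    (hv : ∀ t ∈ Icc 0 T, |v t| ≤ B) :
    |π.rsSum (stepFn z ε n) v| ≤ 2 * B * (|z 0| + ∑ j ∈ Finset.range (n+1), o j) := by
  have hT : 0 ≤ T := by rw [← hn]; positivity
  have hB : 0 ≤ B := (abs_nonneg _).trans (hv 0 ⟨le_rfl, hT⟩)
  have hd : ∀ s ∈ Icc 0 T, |v T - v s| ≤ 2 * B := fun s hs => by
    have := hv s hs
    have := hv T ⟨hT, le_rfl⟩
    have := abs_sub (v T) (v s)
    linarith
  rw [rsSum_stepFn, mul_add]
  refine (abs_add_le _ _).trans (add_le_add ?_ ?_)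
  · rw [abs_mul, mul_comm]
    exact mul_le_mul_of_nonneg_right (hd 0 ⟨le_rfl, hT⟩) (abs_nonneg _)
  · refine (Finset.abs_sum_le_sum_abs _ _).trans ?_
    rw [Finset.sum_range_succ, mul_add, Finset.mul_sum]
    have h0 : 0 ≤ 2 * B * o n := mul_nonneg (by positivity) (ho n le_rfl).1
    refine le_trans (Finset.sum_le_sum fun j hj => ?_) (le_add_of_nonneg_right h0)
    have hj' := Finset.mem_range.1 hj
    rw [abs_mul, mul_comm]
    have ha : (((j+1 : ℕ):ℝ) * ε) ∈ Icc 0 T := by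
      refine ⟨by positivity, ?_⟩
      rw [← hn]
      have : ((j + 1 : ℕ) : ℝ) ≤ n := by exact_mod_cast hj'
      gcongr
      linarith
    obtain ⟨p, hp, -, he⟩ := π.rsSum_indicator _ ha v
    rw [he]
    refine mul_le_mul (hd p hp) ?_ (abs_nonneg _) (by positivity)
    refine (ho j hj'.le).2 _ ?_ _ ?_
    · push_cast; exact ⟨by gcongr; linarith, le_rfl⟩
    · exact ⟨le_rfl, by gcongr; linarith⟩

lemma rsSum_sub_stepFn_le {T : ℝ} (π : TaggedPartition T) (z v : ℝ → ℝ) (ε : ℝ) (hε : 0 < ε)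
    (n : ℕ) (hn : ((n:ℕ) + 1) * ε = T) (o : ℕ → ℝ) (ho : OscBound z ε n o) (L : ℝ) (hL : 0 ≤ L)
    (hv : ∀ i < π.k, |v (π.t (i+1)) - v (π.t i)| ≤ L * min (π.t (i+1) - π.t i) ε) :
    |π.rsSum z v - π.rsSum (stepFn z ε n) v| ≤ 3 * L * ε * ∑ j ∈ Finset.range (n+1), o j := by
  unfold TaggedPartition.rsSum
  rw [← Finset.sum_sub_distrib]
  refine (Finset.abs_sum_le_sum_abs _ _).trans ?_
  have h1 : ∀ i ∈ Finset.range π.k,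
      |z (π.tag i) * (v (π.t (i + 1)) - v (π.t i)) -
        stepFn z ε n (π.tag i) * (v (π.t (i + 1)) - v (π.t i))| ≤
      ∑ j ∈ Finset.range (n+1), o j * L *
        (if π.tag i ∈ Icc (j * ε) ((j + 1) * ε) then min (π.t (i+1) - π.t i) ε else 0) := by
    intro i hi
    have hi' := Finset.mem_range.1 hi
    have hmin : 0 ≤ min (π.t (i+1) - π.t i) ε := le_min (by linarith [π.mono i hi']) hε.le
    have hm := π.tag_mem hi'
    obtain ⟨j, hj, hjt, he⟩ := stepFn_eq z ε hε n _ ⟨hm.1, hm.2.trans hn.ge⟩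
    have h2 := Finset.single_le_sum (f := fun j : ℕ => o j * L *
        (if π.tag i ∈ Icc (j * ε) ((j + 1) * ε) then min (π.t (i+1) - π.t i) ε else 0))
        (s := Finset.range (n+1)) (fun j hj => by
          have := (ho j (by simpa [Nat.lt_succ_iff] using hj)).1
          split_ifs
          · positivity
          · simp) (Finset.mem_range.2 (Nat.lt_succ_of_le hj))
    refine le_trans ?_ h2
    rw [if_pos hjt, ← sub_mul, abs_mul, he, mul_assoc]
    refine mul_le_mul ?_ (hv i hi') (abs_nonneg _) (ho j hj).1
    exact (ho j hj).2 _ hjt _ ⟨le_rfl, by gcongr; linarith⟩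
  refine (Finset.sum_le_sum h1).trans ?_
  rw [Finset.sum_comm, Finset.mul_sum]
  refine Finset.sum_le_sum fun j hj => ?_
  rw [← Finset.mul_sum]
  have h3 := π.sum_min_le (j * ε) ((j + 1) * ε) ε (by gcongr; linarith) hε.le
  have := (ho j (by simpa [Nat.lt_succ_iff] using hj)).1
  calc _ ≤ o j * L * ((↑j + 1) * ε - ↑j * ε + 2 * ε) := by gcongr
    _ = _ := by ring

lemma exists_tendsto_of_approx {ι : Type*} (l : Filter ι) (f : ι → ℝ)
    (H : ∀ η > 0, ∃ G : ι → ℝ, (∃ c, Tendsto G l (nhds c)) ∧ ∀ᶠ x in l, |f x - G x| ≤ η) :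
    ∃ c, Tendsto f l (nhds c) := by
  rcases l.eq_or_neBot with rfl | hl
  · exact ⟨0, tendsto_bot⟩
  rw [← cauchy_map_iff_exists_tendsto, Metric.cauchy_iff]
  refine ⟨hl.map f, fun η hη => ?_⟩
  obtain ⟨G, ⟨c, hc⟩, hG⟩ := H (η / 4) (by positivity)
  refine ⟨Metric.ball c (η / 2), ?_, fun x hx y hy => ?_⟩
  · have := Metric.tendsto_nhds.1 hc (η / 4) (by positivity)
    rw [mem_map]
    filter_upwards [this, hG] with x h1 h2
    simp only [Set.mem_preimage, Metric.mem_ball]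
    rw [Real.dist_eq] at h1 ⊢
    have := abs_sub_le (f x) (G x) c
    linarith
  · rw [Metric.mem_ball] at hx hy
    have := dist_triangle_right x y c
    linarith

/-- The filter of tagged partitions with mesh tending to zero. -/
def meshFilter (T : ℝ) : Filter (TaggedPartition T) := comap TaggedPartition.mesh (nhds 0)

lemma tendsto_mesh (T : ℝ) : Tendsto TaggedPartition.mesh (meshFilter T) (nhds 0) :=
  tendsto_comap

lemma tendsto_rsSum_stepFn {T : ℝ} (z v : ℝ → ℝ) (ε : ℝ) (hε : 0 < ε) (n : ℕ)
    (hn : ((n:ℕ) + 1) * ε = T) (L : ℝ) (hL : 0 ≤ L)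
    (hv : ∀ s ∈ Icc 0 T, ∀ t ∈ Icc 0 T, |v t - v s| ≤ L * |t - s|) :
    ∃ c, Tendsto (fun π : TaggedPartition T => π.rsSum (stepFn z ε n) v) (meshFilter T)
      (nhds c) := by
  simp_rw [rsSum_stepFn]
  refine ⟨z 0 * (v T - v 0) + ∑ j ∈ Finset.range n,
      (z ((j + 1 : ℕ) * ε) - z (j * ε)) * (v T - v ((j + 1 : ℕ) * ε)), ?_⟩
  refine tendsto_const_nhds.add (tendsto_finsetSum _ fun j hj => Tendsto.const_mul _ ?_)
  have hj' := Finset.mem_range.1 hj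
  have ha : (((j+1 : ℕ):ℝ) * ε) ∈ Icc 0 T := by
    refine ⟨by positivity, ?_⟩
    rw [← hn]
    have : ((j + 1 : ℕ) : ℝ) ≤ n := by exact_mod_cast hj'
    gcongr
    linarith
  rw [tendsto_iff_dist_tendsto_zero]
  have h0 : Tendsto (fun π : TaggedPartition T => L * π.mesh) (meshFilter T) (nhds 0) := by
    simpa using (tendsto_mesh T).const_mul L
  refine squeeze_zero (fun _ => dist_nonneg) (fun π => ?_) h0
  obtain ⟨p, hp, hpm, he⟩ := π.rsSum_indicator _ ha v
  rw [he, Real.dist_eq]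
  have := hv p hp _ ha
  rw [abs_sub_comm _ p] at this
  calc _ = |v (((j+1 : ℕ):ℝ) * ε) - v p| := by congr 1; ring
    _ ≤ _ := this.trans (by gcongr)

lemma tendsto_rsSum_lipschitz {T : ℝ} (z v : ℝ → ℝ) (ε : ℕ → ℝ) (hε : ∀ m, 0 < ε m) (n : ℕ → ℕ)
    (hn : ∀ m, ((n m : ℕ) + 1) * ε m = T) (o : ℕ → ℕ → ℝ) (ho : ∀ m, OscBound z (ε m) (n m) (o m))
    (h0 : Tendsto (fun m => ε m * ∑ j ∈ Finset.range (n m + 1), o m j) atTop (nhds 0))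
    (L : ℝ) (hL : 0 ≤ L)
    (hv : ∀ s ∈ Icc 0 T, ∀ t ∈ Icc 0 T, |v t - v s| ≤ L * |t - s|) :
    ∃ c, Tendsto (fun π : TaggedPartition T => π.rsSum z v) (meshFilter T) (nhds c) := by
  refine exists_tendsto_of_approx _ _ fun η hη => ?_
  have h1 : Tendsto (fun m => 3 * L * (ε m * ∑ j ∈ Finset.range (n m + 1), o m j)) atTop
      (nhds 0) := by simpa using h0.const_mul (3 * L)
  obtain ⟨m, hm⟩ := (h1.eventually_lt_const hη).exists
  refine ⟨fun π => π.rsSum (stepFn z (ε m) (n m)) v,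
    tendsto_rsSum_stepFn z v (ε m) (hε m) (n m) (hn m) L hL hv, ?_⟩
  filter_upwards [(tendsto_mesh T).eventually_lt_const (hε m)] with π hπ
  refine (rsSum_sub_stepFn_le π z v (ε m) (hε m) (n m) (hn m) (o m) (ho m) L hL ?_).trans ?_
  · intro i hi
    have h2 := π.step_le_mesh hi
    have h3 := π.mono i hi
    rw [min_eq_left (by linarith)]
    have := hv _ (π.t_mem hi.le) _ (π.t_mem (i := i+1) hi)
    rwa [abs_of_pos (by linarith : 0 < π.t (i+1) - π.t i)] at this
  · calc _ = 3 * L * (ε m * ∑ j ∈ Finset.range (n m + 1), o m j) := by ring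
      _ ≤ η := hm.le

/-- Lipschitz regularisation of a Hölder function by inf-convolution. -/
lemma exists_regularisation {T γ C ε : ℝ} (hT : 0 < T) (hγ : γ ∈ Ioo (0:ℝ) 1) (hC : 0 ≤ C)
    (hε : 0 < ε) (y : ℝ → ℝ)
    (hy : ∀ s ∈ Icc (0:ℝ) T, ∀ t ∈ Icc (0:ℝ) T, |y t - y s| ≤ C * |t - s| ^ γ) :
    ∃ v : ℝ → ℝ, (∀ s ∈ Icc 0 T, ∀ t ∈ Icc 0 T, |v t - v s| ≤ C * ε ^ (γ - 1) * |t - s|) ∧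
      ∀ t ∈ Icc 0 T, |v t - y t| ≤ C * ε ^ γ := by
  have hne : Nonempty (Icc (0:ℝ) T) := ⟨⟨0, le_rfl, hT.le⟩⟩
  set L := C * ε ^ (γ - 1) with hLdef
  have hL : 0 ≤ L := by positivity
  have key : ∀ r : ℝ, 0 ≤ r → C * r ^ γ ≤ L * r + C * ε ^ γ := by
    intro r hr
    rcases le_total r ε with h | h
    · have : r ^ γ ≤ ε ^ γ := Real.rpow_le_rpow hr h hγ.1.le
      have : C * r ^ γ ≤ C * ε ^ γ := by gcongr
      have : 0 ≤ L * r := by positivity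
      linarith
    · have hr' : 0 < r := hε.trans_le h
      have h1 : r ^ (γ - 1) ≤ ε ^ (γ - 1) :=
        Real.rpow_le_rpow_of_nonpos hε h (by linarith [hγ.2])
      have h2 : r ^ γ = r ^ (γ - 1) * r := by
        rw [Real.rpow_sub_one hr'.ne']; field_simp
      have h3 : C * r ^ γ ≤ L * r := by
        rw [h2, hLdef, mul_assoc]; gcongr
      have : 0 ≤ C * ε ^ γ := by positivity
      linarith
  have low : ∀ t ∈ Icc (0:ℝ) T, ∀ s : Icc (0:ℝ) T, y t - C * ε ^ γ ≤ y s + L * |t - s| := by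
    intro t ht s
    have h1 := hy s s.2 t ht
    have h2 := key |t - s| (abs_nonneg _)
    have h3 := le_abs_self (y t - y s)
    linarith
  have bdd : ∀ t ∈ Icc (0:ℝ) T, BddBelow (range fun s : Icc (0:ℝ) T => y s + L * |t - s|) :=
    fun t ht => ⟨y t - C * ε ^ γ, by rintro _ ⟨s, rfl⟩; exact low t ht s⟩
  refine ⟨fun t => ⨅ s : Icc (0:ℝ) T, (y s + L * |t - s|), ?_, ?_⟩
  · have one : ∀ s ∈ Icc (0:ℝ) T, ∀ t ∈ Icc (0:ℝ) T,
        (⨅ r : Icc (0:ℝ) T, (y r + L * |t - r|)) - L * |t - s| ≤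
        ⨅ r : Icc (0:ℝ) T, (y r + L * |s - r|) := by
      intro s hs t ht
      refine le_ciInf fun r => ?_
      have h1 := ciInf_le (bdd t ht) r
      have h2 : L * |t - r| ≤ L * |t - s| + L * |s - r| := by
        rw [← mul_add]; gcongr; exact abs_sub_le _ _ _
      linarith
    intro s hs t ht
    have h1 := one s hs t ht
    have h2 := one t ht s hs
    rw [abs_sub_comm s t] at h2
    rw [abs_le]
    constructor <;> linarith
  · intro t ht
    have h1 := ciInf_le (bdd t ht) ⟨t, ht⟩
    have h2 := le_ciInf (low t ht)
    simp only [sub_self, abs_zero, mul_zero, add_zero] at h1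
    have : 0 ≤ C * ε ^ γ := by positivity
    rw [abs_le]
    constructor <;> linarith

/-- The deterministic convergence theorem. -/
theorem deterministic_convergence {T γ : ℝ} (hT : 0 < T) (hγ : γ ∈ Ioo (0:ℝ) 1) (z y : ℝ → ℝ)
    (hy : HolderOnIcc γ T y) (o : ℕ → ℕ → ℝ)
    (ho : ∀ m, OscBound z (T / 2 ^ m) (2 ^ m - 1) (o m))
    (hsum : Summable fun m => (T / 2 ^ m) ^ γ * ∑ j ∈ Finset.range (2 ^ m), o m j) :
    ∃ c, Tendsto (fun π : TaggedPartition T => π.rsSum z y) (meshFilter T) (nhds c) := by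
  obtain ⟨C', hC'⟩ := hy
  obtain ⟨C, hC, hy⟩ : ∃ C, 0 ≤ C ∧ ∀ s ∈ Icc (0:ℝ) T, ∀ t ∈ Icc (0:ℝ) T,
      |y t - y s| ≤ C * |t - s| ^ γ :=
    ⟨|C'|, abs_nonneg _, fun s hs t ht => (hC' s hs t ht).trans
      (by gcongr; exact le_abs_self _)⟩
  set ε : ℕ → ℝ := fun m => T / 2 ^ m with hεdef
  have hε : ∀ m, 0 < ε m := fun m => by positivity
  have hn1 : ∀ m, 2 ^ m - 1 + 1 = 2 ^ m := fun m => Nat.sub_add_cancel Nat.one_le_two_pow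
  have hn : ∀ m, (((2 ^ m - 1 : ℕ) : ℝ) + 1) * ε m = T := fun m => by
    have : (((2 ^ m - 1 : ℕ) : ℝ) + 1) = 2 ^ m := by exact_mod_cast hn1 m
    rw [this, hεdef]; field_simp
  set O : ℕ → ℝ := fun m => ∑ j ∈ Finset.range (2 ^ m), o m j with hO
  have hO0 : ∀ m, 0 ≤ O m := fun m => Finset.sum_nonneg fun j hj =>
    (ho m j (by have := Finset.mem_range.1 hj; omega)).1
  have hgeo : Summable fun m => ε m ^ γ := by
    have : ∀ m, ε m ^ γ = T ^ γ * ((1 / 2 : ℝ) ^ γ) ^ m := fun m => by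
      rw [hεdef, ← Real.rpow_natCast, ← Real.rpow_mul (by norm_num), mul_comm γ,
        Real.rpow_mul (by norm_num), ← Real.mul_rpow hT.le (by positivity), Real.rpow_natCast]
      congr 1
      simp [div_eq_mul_inv]
    simp_rw [this]
    exact (summable_geometric_of_lt_one (by positivity)
      (Real.rpow_lt_one (by norm_num) (by norm_num) hγ.1)).mul_left _
  have hεlim : Tendsto (fun m => C * ε m ^ γ) atTop (nhds 0) := by
    simpa using hgeo.tendsto_atTop_zero.const_mul C
  have h0 : Tendsto (fun m => ε m * ∑ j ∈ Finset.range (2 ^ m - 1 + 1), o m j) atTop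
      (nhds 0) := by
    have h1 : Tendsto (fun m => T ^ (1 - γ) * (ε m ^ γ * O m)) atTop (nhds 0) := by
      simpa using hsum.tendsto_atTop_zero.const_mul (T ^ (1 - γ))
    refine squeeze_zero (fun m => ?_) (fun m => ?_) h1
    · rw [hn1]; exact mul_nonneg (hε m).le (hO0 m)
    · rw [hn1]
      have h2 : ε m = ε m ^ (1 - γ) * ε m ^ γ := by
        rw [← Real.rpow_add (hε m)]; simp
      have h3 : ε m ^ (1 - γ) ≤ T ^ (1 - γ) :=
        Real.rpow_le_rpow (hε m).le (div_le_self hT.le (one_le_pow₀ (by norm_num)))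
          (by linarith [hγ.2])
      have h4 := hO0 m
      have h5 := (hε m).le
      calc ε m * O m = ε m ^ (1 - γ) * (ε m ^ γ * O m) := by
            conv_lhs => rw [h2]
            ring
        _ ≤ _ := by gcongr
  choose v hv1 hv2 using fun m => exists_regularisation hT hγ hC (hε m) y hy
  have hεs : ∀ m, ε (m+1) = ε m / 2 := fun m => by
    simp only [hεdef, pow_succ]; field_simp
  have hu1 : ∀ m, ∀ s ∈ Icc 0 T, ∀ t ∈ Icc 0 T,
      |(v (m+1) t - v m t) - (v (m+1) s - v m s)| ≤ 4 * C * ε m ^ (γ - 1) * |t - s| := by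
    intro m s hs t ht
    have h1 := hv1 m s hs t ht
    have h2 := hv1 (m+1) s hs t ht
    have h3 : ε (m+1) ^ (γ - 1) ≤ 2 * ε m ^ (γ - 1) := by
      rw [hεs, Real.div_rpow (hε m).le (by norm_num), div_le_iff₀ (by positivity)]
      have : 1 / 2 ≤ (2:ℝ) ^ (γ - 1) := by
        have := Real.rpow_le_rpow_of_exponent_le (x := 2) (by norm_num)
          (by linarith [hγ.1] : (-1:ℝ) ≤ γ - 1)
        rwa [Real.rpow_neg_one, ← one_div] at this
      have h6 : 0 ≤ ε m ^ (γ - 1) := by have := hε m; positivity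
      nlinarith
    have h4 : C * ε (m+1) ^ (γ - 1) * |t - s| ≤ C * (2 * ε m ^ (γ - 1)) * |t - s| := by gcongr
    have h5 : 0 ≤ C * ε m ^ (γ - 1) * |t - s| := by have := hε m; positivity
    calc _ = |(v (m+1) t - v (m+1) s) - (v m t - v m s)| := by congr 1; ring
      _ ≤ |v (m+1) t - v (m+1) s| + |v m t - v m s| := abs_sub _ _
      _ ≤ _ := by linarith
  have hu2 : ∀ m, ∀ t ∈ Icc 0 T, |v (m+1) t - v m t| ≤ 2 * C * ε m ^ γ := by
    intro m t ht
    have h1 := hv2 m t ht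
    have h2 := hv2 (m+1) t ht
    have h3 : ε (m+1) ^ γ ≤ ε m ^ γ :=
      Real.rpow_le_rpow (hε _).le (by rw [hεs]; linarith [hε m]) hγ.1.le
    have h4 : C * ε (m+1) ^ γ ≤ C * ε m ^ γ := by gcongr
    calc _ = |(v (m+1) t - y t) - (v m t - y t)| := by congr 1; ring
      _ ≤ |v (m+1) t - y t| + |v m t - y t| := abs_sub _ _
      _ ≤ _ := by linarith
  -- the uniform bound
  set bound : ℕ → ℝ := fun m => 4 * C * |z 0| * ε m ^ γ + 16 * C * (ε m ^ γ * O m) with hbound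
  have hbs : Summable bound := (hgeo.mul_left _).add (hsum.mul_left _)
  have hb : ∀ (π : TaggedPartition T) m,
      |π.rsSum z (fun t => v (m+1) t - v m t)| ≤ bound m := by
    intro π m
    have hεm := hε m
    have h1 := rsSum_stepFn_le π z (fun t => v (m+1) t - v m t) (ε m) (hε m) _ (hn m) (o m) (ho m)
      _ (hu2 m)
    have h2 := rsSum_sub_stepFn_le π z (fun t => v (m+1) t - v m t) (ε m) (hε m) _ (hn m) (o m)
      (ho m) (4 * C * ε m ^ (γ - 1)) (by positivity) (by
        intro i hi
        have ht1 := π.t_mem hi.le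
        have ht2 := π.t_mem (i := i+1) hi
        have h3 := hu1 m _ ht1 _ ht2
        rw [abs_of_pos (by linarith [π.mono i hi] : 0 < π.t (i+1) - π.t i)] at h3
        rcases min_choice (π.t (i+1) - π.t i) (ε m) with h | h
        · rw [h]; exact h3
        · rw [h]
          have h4 := hu2 m _ ht1
          have h5 := hu2 m _ ht2
          have h6 : ε m ^ (γ - 1) * ε m = ε m ^ γ := by
            rw [Real.rpow_sub_one (hε m).ne']; field_simp
          rw [mul_assoc, h6]
          refine (abs_sub _ _).trans ?_
          linarith)
    rw [hn1] at h1 h2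
    have h6 : ε m ^ (γ - 1) * ε m = ε m ^ γ := by
      rw [Real.rpow_sub_one (hε m).ne']; field_simp
    have h7 : 3 * (4 * C * ε m ^ (γ - 1)) * ε m * ∑ j ∈ Finset.range (2 ^ m), o m j
        = 12 * C * (ε m ^ γ * O m) := by
      rw [← h6]; ring
    rw [h7] at h2
    have h8 : 2 * (2 * C * ε m ^ γ) * (|z 0| + ∑ j ∈ Finset.range (2 ^ m), o m j) =
      4 * C * |z 0| * ε m ^ γ + 4 * C * (ε m ^ γ * O m) := by ring
    rw [h8] at h1
    have h9 := abs_sub_abs_le_abs_sub (π.rsSum z (fun t => v (m+1) t - v m t))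
      (π.rsSum (stepFn z (ε m) (2 ^ m - 1)) (fun t => v (m+1) t - v m t))
    simp only [hbound]
    linarith
  have hhas : ∀ π : TaggedPartition T,
      HasSum (fun m => π.rsSum z (fun t => v (m+1) t - v m t)) (π.rsSum z y - π.rsSum z (v 0)) := by
    intro π
    rw [hasSum_iff_tendsto_nat_of_summable_norm
      (Summable.of_nonneg_of_le (fun _ => norm_nonneg _) (fun m => hb π m) hbs)]
    have h1 : ∀ N, ∑ m ∈ Finset.range N, π.rsSum z (fun t => v (m+1) t - v m t) =
        π.rsSum z (v N) - π.rsSum z (v 0) := by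
      intro N
      simp_rw [TaggedPartition.rsSum_sub_right]
      exact Finset.sum_range_sub (fun m => π.rsSum z (v m)) N
    simp_rw [h1]
    refine Tendsto.sub_const ?_ _
    have h2 : ∀ t ∈ Icc 0 T, Tendsto (fun m => v m t) atTop (nhds (y t)) := by
      intro t ht
      rw [tendsto_iff_dist_tendsto_zero]
      exact squeeze_zero (fun _ => dist_nonneg) (fun m => hv2 m t ht) hεlim
    unfold TaggedPartition.rsSum
    refine tendsto_finsetSum _ fun i hi => Tendsto.const_mul _ ?_
    have hi' := Finset.mem_range.1 hi
    exact (h2 _ (π.t_mem (i := i+1) hi')).sub (h2 _ (π.t_mem hi'.le))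
  have heq : ∀ π : TaggedPartition T, π.rsSum z y =
      π.rsSum z (v 0) + ∑' m, π.rsSum z (fun t => v (m+1) t - v m t) := fun π => by
    rw [(hhas π).tsum_eq]; ring
  simp_rw [heq]
  obtain ⟨c0, hc0⟩ := tendsto_rsSum_lipschitz z (v 0) ε hε _ hn o ho h0 _
    (by have := hε 0; positivity) (hv1 0)
  choose c hc using fun m => tendsto_rsSum_lipschitz z (fun t => v (m+1) t - v m t) ε hε _ hn o ho
    h0 (4 * C * ε m ^ (γ - 1)) (by have := hε m; positivity) (hu1 m)
  exact ⟨_, hc0.add (tendsto_tsum_of_dominated_convergence hbs hc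
    (Eventually.of_forall fun π m => hb π m))⟩

/-- localised increment of the monotone function `V` -/
def incr (V : ℝ → ℝ) (N r : ℝ) (x : ℝ) : ℝ≥0∞ :=
  (Icc (-N) N).indicator (fun x => ENNReal.ofReal (V (x + r) - V (x - r))) x

lemma measurable_incr (V : ℝ → ℝ) (hV : Monotone V) (N r : ℝ) : Measurable (incr V N r) := by
  unfold incr
  refine Measurable.indicator ?_ measurableSet_Icc
  have := hV.measurable
  fun_prop

lemma lintegral_incr_le (V : ℝ → ℝ) (hV : Monotone V) (N r : ℝ) (hN : 0 ≤ N) (hr : 0 ≤ r) :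
    ∫⁻ x, incr V N r x ≤ ENNReal.ofReal (2 * r * (V (N + r) - V (-N - r))) := by
  unfold incr
  rw [lintegral_indicator measurableSet_Icc, setLIntegral_congr Ioc_ae_eq_Icc.symm]
  have hi : ∀ a b, IntervalIntegrable V volume a b := fun a b => hV.intervalIntegrable
  have hm1 : Monotone fun x => V (x + r) := fun a b hab => hV (by linarith)
  have hm2 : Monotone fun x => V (x - r) := fun a b hab => hV (by linarith)
  have hi1 : IntervalIntegrable (fun x => V (x + r)) volume (-N) N := hm1.intervalIntegrable
  have hi2 : IntervalIntegrable (fun x => V (x - r)) volume (-N) N := hm2.intervalIntegrable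
  rw [← ofReal_integral_eq_lintegral_ofReal]
  · apply ENNReal.ofReal_le_ofReal
    rw [← intervalIntegral.integral_of_le (by linarith), intervalIntegral.integral_sub hi1 hi2,
      intervalIntegral.integral_comp_add_right, intervalIntegral.integral_comp_sub_right,
      intervalIntegral.integral_interval_sub_interval_comm' (hi _ _) (hi _ _) (hi _ _)]
    have h1 : ∫ x in (N - r)..(N + r), V x ≤ ∫ x in (N - r)..(N + r), V (N + r) :=
      intervalIntegral.integral_mono_on (by linarith) (hi _ _) (by simp) fun x hx => hV hx.2
    have h2 : ∫ x in (-N - r)..(-N + r), V (-N - r) ≤ ∫ x in (-N - r)..(-N + r), V x :=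
      intervalIntegral.integral_mono_on (by linarith) (by simp) (hi _ _) fun x hx => hV hx.1
    rw [intervalIntegral.integral_const, smul_eq_mul] at h1 h2
    linarith
  · exact (hi1.sub hi2).1
  · exact Eventually.of_forall fun x => sub_nonneg.2 (hV (by linarith))

lemma sum_cells (f : ℝ → ℝ≥0∞) (ε : ℝ) (hε : 0 ≤ ε) (n : ℕ) :
    ∑ j ∈ Finset.range n, ∫⁻ u in Ioc (j * ε) ((j + 1) * ε), f u = ∫⁻ u in Ioc 0 (n * ε), f u := by
  induction n with
  | zero => simp
  | succ n ih =>
    rw [Finset.sum_range_succ, ih, ← lintegral_union measurableSet_Ioc, Ioc_union_Ioc_eq_Ioc]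
    · push_cast; rfl
    · positivity
    · gcongr; linarith
    · rw [Set.disjoint_left]
      intro x hx hx'
      exact absurd hx.2 (not_le.2 hx'.1)

lemma pathwise {T α γ : ℝ} (hT : 0 < T) (hα : α ∈ Ioo (0:ℝ) 1) (hγ : γ ∈ Ioo (0:ℝ) 1)
    (x y h V : ℝ → ℝ) (hV : Monotone V)
    (hhV : ∀ a b, a ≤ b → |h b - h a| ≤ V b - V a) (N : ℝ) (hN : 0 ≤ N)
    (hxN : ∀ t ∈ Icc 0 T, |x t| ≤ N)
    (hxH : ∀ s ∈ Icc (0:ℝ) T, ∀ t ∈ Icc (0:ℝ) T, |x t - x s| ≤ N * |t - s| ^ α)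
    (hfin : ∑' m : ℕ, ENNReal.ofReal ((T / 2 ^ m) ^ (γ - 1)) *
      ∫⁻ u in Ioc 0 T, incr V N (N * (T / 2 ^ m) ^ α) (x u) ≠ ⊤)
    (hy : HolderOnIcc γ T y) :
    ∃ c, Tendsto (fun π : TaggedPartition T => π.rsSum (fun t => h (x t)) y) (meshFilter T)
      (nhds c) := by
  have hhV' : ∀ a b p q, a ∈ Icc p q → b ∈ Icc p q → |h a - h b| ≤ V q - V p := by
    intro a b p q ha hb
    rcases le_total a b with hab | hab
    · rw [abs_sub_comm]
      linarith [hhV a b hab, hV ha.1, hV hb.2]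
    · linarith [hhV b a hab, hV hb.1, hV ha.2]
  have hB : ∀ m : ℕ, ∫⁻ u in Ioc 0 T, incr V N (N * (T / 2 ^ m) ^ α) (x u) ≠ ⊤ := by
    intro m hm
    have h1 := ENNReal.ne_top_of_tsum_ne_top hfin m
    rw [hm, ENNReal.mul_top] at h1
    · exact h1 rfl
    · rw [Ne, ENNReal.ofReal_eq_zero, not_le]; positivity
  have hcell : ∀ m j : ℕ, j < 2 ^ m → ((j:ℝ) + 1) * (T / 2 ^ m) ≤ T := by
    intro m j hj
    have : ((j:ℝ) + 1) ≤ 2 ^ m := by exact_mod_cast hj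
    calc _ ≤ (2 ^ m : ℝ) * (T / 2 ^ m) := by gcongr
      _ = T := by field_simp
  have hsub : ∀ m j : ℕ, j < 2 ^ m →
      Ioc ((j:ℝ) * (T / 2 ^ m)) ((j + 1) * (T / 2 ^ m)) ⊆ Ioc 0 T := fun m j hj =>
    Ioc_subset_Ioc (by positivity) (hcell m j hj)
  have hBj : ∀ m j : ℕ, j < 2 ^ m → ∫⁻ u in Ioc ((j:ℝ) * (T / 2 ^ m)) ((j + 1) * (T / 2 ^ m)),
      incr V N (N * (T / 2 ^ m) ^ α) (x u) ≠ ⊤ := fun m j hj =>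
    ne_top_of_le_ne_top (hB m) (lintegral_mono_set (hsub m j hj))
  refine deterministic_convergence hT hγ _ y hy (fun m j => (T / 2 ^ m)⁻¹ *
    (∫⁻ u in Ioc ((j:ℝ) * (T / 2 ^ m)) ((j + 1) * (T / 2 ^ m)),
      incr V N (N * (T / 2 ^ m) ^ α) (x u)).toReal) ?_ ?_
  · intro m j hj
    have hj' : j < 2 ^ m := by have := Nat.one_le_two_pow (n := m); omega
    set ε := T / 2 ^ m with hεdef
    have hε : 0 < ε := by positivity
    refine ⟨by positivity, fun s hs t ht => ?_⟩
    dsimp only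
    rw [inv_mul_eq_div, le_div_iff₀ hε]
    have hin : ∀ u ∈ Icc ((j:ℝ) * ε) ((j+1) * ε), u ∈ Icc 0 T := fun u hu =>
      ⟨le_trans (by positivity) hu.1, hu.2.trans (hcell m j hj')⟩
    have h1 : ENNReal.ofReal |h (x s) - h (x t)| * ENNReal.ofReal ε ≤
        ∫⁻ u in Ioc ((j:ℝ) * ε) ((j + 1) * ε), incr V N (N * ε ^ α) (x u) := by
      have h2 : ENNReal.ofReal ε = volume (Ioc ((j:ℝ) * ε) ((j + 1) * ε)) := by
        rw [Real.volume_Ioc]; congr 1; ring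
      rw [h2, ← setLIntegral_const]
      refine setLIntegral_mono' measurableSet_Ioc fun u hu => ?_
      have hu' := Ioc_subset_Icc_self hu
      unfold incr
      have hmem : x u ∈ Icc (-N) N := abs_le.1 (hxN u (hin u hu'))
      rw [indicator_of_mem hmem]
      apply ENNReal.ofReal_le_ofReal
      have hd : ∀ w ∈ Icc ((j:ℝ) * ε) ((j+1) * ε),
          x w ∈ Icc (x u - N * ε ^ α) (x u + N * ε ^ α) := by
        intro w hw
        have h3 := hxH u (hin u hu') w (hin w hw)
        have h4 : |w - u| ≤ ε := by
          rw [abs_le]; constructor <;> linarith [hw.1, hw.2, hu'.1, hu'.2]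
        have h5 : N * |w - u| ^ α ≤ N * ε ^ α := by
          gcongr; exact hα.1.le
        have := abs_le.1 (h3.trans h5)
        constructor <;> linarith
      exact hhV' _ _ _ _ (hd s hs) (hd t ht)
    have h6 := ENNReal.toReal_mono (hBj m j hj') h1
    rwa [ENNReal.toReal_mul, ENNReal.toReal_ofReal (abs_nonneg _), ENNReal.toReal_ofReal hε.le] at h6
  · have h1 := ENNReal.summable_toReal hfin
    refine h1.congr fun m => ?_
    set ε := T / 2 ^ m with hεdef
    have hε : 0 < ε := by positivity
    rw [← Finset.mul_sum, ← ENNReal.toReal_sum (fun j hj => hBj m j (Finset.mem_range.1 hj)),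
      sum_cells (fun u => incr V N (N * ε ^ α) (x u)) ε hε.le, ENNReal.toReal_mul,
      ENNReal.toReal_ofReal (by positivity), Real.rpow_sub_one hε.ne']
    have : (((2 ^ m : ℕ)) : ℝ) * ε = T := by rw [hεdef]; push_cast; field_simp
    rw [this]
    field_simp

lemma ae_finite {Ω : Type*} [MeasurableSpace Ω] (P : Measure Ω) [IsProbabilityMeasure P]
    (T α γ : ℝ) (hT : 0 < T) (hα : α ∈ Set.Ioo (0:ℝ) 1)
    (hαγ : 1 < α + γ)
    (X : ℝ → Ω → ℝ) (hX : Measurable (Function.uncurry X))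
    (g : ℝ → ℝ) (hgL1 : IntegrableOn g (Set.Icc 0 T))
    (hdens : BoundedDensityAssumption P T X g) (V : ℝ → ℝ) (hV : Monotone V) (N : ℝ) (hN : 0 ≤ N) :
    ∀ᵐ ω ∂P, ∑' m : ℕ, ENNReal.ofReal ((T / 2 ^ m) ^ (γ - 1)) *
      ∫⁻ u in Ioc 0 T, incr V N (N * (T / 2 ^ m) ^ α) (X u ω) ≠ ⊤ := by
  have hmeas : ∀ r, Measurable (fun p : ℝ × Ω => incr V N r (X p.1 p.2)) := fun r =>
    (measurable_incr V hV N r).comp hX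
  have hmB : ∀ r, Measurable fun ω => ∫⁻ u in Ioc 0 T, incr V N r (X u ω) := fun r =>
    (hmeas r).lintegral_prod_left'
  set W := V (N + N * T ^ α) - V (-N - N * T ^ α) with hW
  have hW0 : 0 ≤ W := by
    have : 0 ≤ N * T ^ α := by positivity
    exact sub_nonneg.2 (hV (by linarith))
  set G := ∫⁻ t in Ioc 0 T, ENNReal.ofReal (g t) with hG
  have hGfin : G ≠ ⊤ := by
    have h1 : IntegrableOn g (Ioc 0 T) := hgL1.mono_set Ioc_subset_Icc_self
    exact ((lintegral_mono fun t => (ENNReal.ofReal_le_ofReal (le_abs_self (g t))).trans_eq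
      (Real.enorm_eq_ofReal_abs (g t)).symm).trans_lt h1.2).ne
  have hE : ∀ r, 0 ≤ r → r ≤ N * T ^ α →
      ∫⁻ ω, (∫⁻ u in Ioc 0 T, incr V N r (X u ω)) ∂P ≤ G * ENNReal.ofReal (2 * r * W) := by
    intro r hr hr'
    rw [lintegral_lintegral_swap (f := fun ω u => incr V N r (X u ω))
      ((hmeas r).comp measurable_swap).aemeasurable, hG,
      ← lintegral_mul_const' _ _ ENNReal.ofReal_ne_top]
    refine lintegral_mono_ae ?_
    filter_upwards [ae_restrict_of_ae_restrict_of_subset Ioc_subset_Icc_self hdens] with t ht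
    have hXt : Measurable (X t) := hX.comp (measurable_prodMk_left)
    rw [← lintegral_map (measurable_incr V hV N r) hXt]
    have hle : P.map (X t) ≤ ENNReal.ofReal (g t) • (volume : Measure ℝ) := by
      refine Measure.le_iff.2 fun A hA => ?_
      rw [Measure.map_apply hXt hA]
      exact ht A hA
    refine (lintegral_mono' hle le_rfl).trans ?_
    rw [lintegral_smul_measure, smul_eq_mul]
    gcongr
    refine (lintegral_incr_le V hV N r hN hr).trans (ENNReal.ofReal_le_ofReal ?_)
    have h1 : V (N + r) ≤ V (N + N * T ^ α) := hV (by linarith)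
    have h2 : V (-N - N * T ^ α) ≤ V (-N - r) := hV (by linarith)
    gcongr
    linarith
  have hmain : ∫⁻ ω, ∑' m : ℕ, ENNReal.ofReal ((T / 2 ^ m) ^ (γ - 1)) *
      (∫⁻ u in Ioc 0 T, incr V N (N * (T / 2 ^ m) ^ α) (X u ω)) ∂P ≠ ⊤ := by
    rw [lintegral_tsum fun m => ((hmB _).const_mul _).aemeasurable]
    have hle : ∀ m : ℕ, ∫⁻ ω, ENNReal.ofReal ((T / 2 ^ m) ^ (γ - 1)) *
        (∫⁻ u in Ioc 0 T, incr V N (N * (T / 2 ^ m) ^ α) (X u ω)) ∂P ≤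
        G * ENNReal.ofReal (2 * N * W * T ^ (α + γ - 1) * ((1 / 2 : ℝ) ^ (α + γ - 1)) ^ m) := by
      intro m
      have hε : 0 < T / 2 ^ m := by positivity
      rw [lintegral_const_mul _ (hmB _)]
      refine (mul_le_mul_right (hE (N * (T / 2 ^ m) ^ α) (by positivity) ?_) _).trans ?_
      · gcongr
        · exact hα.1.le
        · exact div_le_self hT.le (one_le_pow₀ (by norm_num))
      · rw [mul_left_comm, ← ENNReal.ofReal_mul (by positivity)]
        refine mul_le_mul_right (ENNReal.ofReal_le_ofReal ?_) _
        apply le_of_eq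
        have h1 : (T / 2 ^ m) ^ (α + γ - 1) =
            T ^ (α + γ - 1) * ((1 / 2 : ℝ) ^ (α + γ - 1)) ^ m := by
          rw [Real.rpow_pow_comm (by norm_num), ← Real.mul_rpow hT.le (by positivity)]
          congr 1
          simp [div_eq_mul_inv]
        rw [mul_assoc _ (T ^ _), ← h1, show α + γ - 1 = (γ - 1) + α by ring, Real.rpow_add hε]
        ring
    refine ne_top_of_le_ne_top ?_ (ENNReal.tsum_le_tsum hle)
    rw [ENNReal.tsum_mul_left]
    refine ENNReal.mul_ne_top hGfin ?_
    refine Summable.tsum_ofReal_ne_top ?_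
    exact (summable_geometric_of_lt_one (by positivity)
      (Real.rpow_lt_one (by norm_num) (by norm_num) (by linarith))).mul_left _
  filter_upwards [ae_lt_top (Measurable.tsum fun m => (hmB _).const_mul _) hmain] with ω hω
  exact hω.ne

/-- the Riemann–Stieltjes sums `Σ_i h(X_{τ_i})(Y_{t_i} - Y_{t_{i-1}})` converge
almost surely, along any sequence of tagged partitions with vanishing mesh, to one and the
same random variable `I`. -/
theorem riemann_stieltjes_sums_converge
    {Ω : Type*} [MeasurableSpace Ω] (P : Measure Ω) [IsProbabilityMeasure P]
    (T α γ : ℝ) (hT : 0 < T) (hα : α ∈ Set.Ioo (0:ℝ) 1) (hγ : γ ∈ Set.Ioo (0:ℝ) 1)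
    (hαγ : 1 < α + γ)
    (X : ℝ → Ω → ℝ) (hX : Measurable (Function.uncurry X))
    (hXHolder : ∀ᵐ ω ∂P, HolderOnIcc α T (fun t => X t ω))
    (g : ℝ → ℝ) (hg0 : ∀ t, 0 ≤ g t) (hgL1 : IntegrableOn g (Set.Icc 0 T))
    (hdens : BoundedDensityAssumption P T X g)
    (h : ℝ → ℝ) (hlc : ∀ x : ℝ, ContinuousWithinAt h (Set.Iic x) x)
    (hbv : LocallyBoundedVariationOn h Set.univ)
    (Y : ℝ → Ω → ℝ) (hYHolder : ∀ᵐ ω ∂P, HolderOnIcc γ T (fun t => Y t ω)) :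
    ∃ I : Ω → ℝ, ∀ π : ℕ → TaggedPartition T,
      Tendsto (fun n => (π n).mesh) atTop (nhds 0) →
      ∀ᵐ ω ∂P, Tendsto
        (fun n => (π n).rsSum (fun u => h (X u ω)) (fun u => Y u ω))
        atTop (nhds (I ω)) := by
  obtain ⟨p, q, hp, hq, hpq⟩ := hbv.exists_monotoneOn_sub_monotoneOn
  rw [monotoneOn_univ] at hp hq
  have hV : Monotone (p + q) := hp.add hq
  have hhV : ∀ a b, a ≤ b → |h b - h a| ≤ (p + q) b - (p + q) a := by
    intro a b hab
    have h1 := hp hab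
    have h2 := hq hab
    simp only [hpq, Pi.sub_apply, Pi.add_apply]
    rw [abs_le]
    constructor <;> linarith
  have hae : ∀ᵐ ω ∂P, ∃ c, Tendsto (fun π : TaggedPartition T =>
      π.rsSum (fun u => h (X u ω)) (fun u => Y u ω)) (meshFilter T) (nhds c) := by
    have hall := ae_all_iff.2 fun N : ℕ => ae_finite P T α γ hT hα hαγ X hX g hgL1 hdens (p + q) hV
      (N : ℝ) N.cast_nonneg
    filter_upwards [hall, hXHolder, hYHolder] with ω hfin hXω hYω
    obtain ⟨C, hC⟩ := hXω
    obtain ⟨N, hN⟩ := exists_nat_ge (max |C| (|X 0 ω| + |C| * T ^ α))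
    have hN1 := (le_max_left _ _).trans hN
    have hN2 := (le_max_right _ _).trans hN
    refine pathwise hT hα hγ (fun t => X t ω) (fun u => Y u ω) h (p + q) hV hhV N
      N.cast_nonneg ?_ ?_ (hfin N) hYω
    · intro t ht
      have h1 := hC 0 ⟨le_rfl, hT.le⟩ t ht
      have h2 : C * |t - 0| ^ α ≤ |C| * T ^ α := by
        rw [sub_zero, abs_of_nonneg ht.1]
        have : t ^ α ≤ T ^ α := Real.rpow_le_rpow ht.1 ht.2 hα.1.le
        have h3 : 0 ≤ t ^ α := Real.rpow_nonneg ht.1 _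
        calc C * t ^ α ≤ |C| * t ^ α := by gcongr; exact le_abs_self _
          _ ≤ _ := by gcongr
      have h3 := abs_sub_abs_le_abs_sub (X t ω) (X 0 ω)
      dsimp only at h1 ⊢
      linarith
    · intro s hs t ht
      refine (hC s hs t ht).trans ?_
      gcongr
      exact (le_abs_self _).trans hN1
  classical
  refine ⟨fun ω => if hω : ∃ c, Tendsto (fun π : TaggedPartition T =>
      π.rsSum (fun u => h (X u ω)) (fun u => Y u ω)) (meshFilter T) (nhds c)
      then hω.choose else 0, fun π hπ => ?_⟩
  filter_upwards [hae] with ω hω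
  rw [dif_pos hω]
  exact hω.choose_spec.comp (tendsto_comap_iff.2 hπ)

end
end

section
/- Let T > 0 and let α, γ ∈ (0,1) with α + γ > 1. Let (X_t)_{t∈[0,T]} be a jointly measurable real-valued stochastic process whose sample paths are almost surely α-Hölder continuous and which satisfies the bounded-density assumption with some nonnegative g ∈ L¹([0,T]); let h : ℝ → ℝ be left-continuous and of locally bounded variation; let Z_t := h(X_t); and let (Y_t)_{t∈[0,T]} be a stochastic process whose sample paths are almost surely γ-Hölder continuous. Then there exist random variables I and I′ such that for every sequence (π_n) of tagged partitions of [0,T] with mesh |π_n| → 0, almost surely Σ_{i} Z_{τ_i^n} (Y_{t_i^n} − Y_{t_{i−1}^n}) → I and Σ_{i} Y_{τ_i^n} (Z_{t_i^n} − Z_{t_{i−1}^n}) → I′ as n → ∞, and moreover the integration-by-parts formula I = Z_T Y_T − Z_0 Y_0 − I′ holds almost surely. -/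
open MeasureTheory Set Filter
open scoped ENNReal

noncomputable section

/-- Pathwise control: products of increments are dominated by a superadditive function times a
positive power of the length. -/
def PathControl (T ε : ℝ) (w : ℝ → ℝ → ℝ) (Z Y : ℝ → ℝ) : Prop :=
  (∀ s t, 0 ≤ s → s ≤ t → t ≤ T → 0 ≤ w s t) ∧
  (∀ s u t, 0 ≤ s → s ≤ u → u ≤ t → t ≤ T → w s u + w u t ≤ w s t) ∧
  (∀ s t, 0 ≤ s → s ≤ t → t ≤ T → ∀ a ∈ Icc s t, ∀ b ∈ Icc s t, ∀ c ∈ Icc s t, ∀ d ∈ Icc s t,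
    |Z a - Z b| * |Y c - Y d| ≤ w s t * (t - s) ^ ε)

lemma exists_split (u : ℕ → ℝ) (a : ℕ) (m : ℝ) (ha : u a ≤ m) :
    ∀ b, a < b → m ≤ u b → ∃ j, a ≤ j ∧ j < b ∧ u j ≤ m ∧ m ≤ u (j + 1) := by
  intro b hab
  induction b, hab using Nat.le_induction with
  | base => intro h; exact ⟨a, le_rfl, Nat.lt_succ_self a, ha, h⟩
  | succ b hb ih =>
    intro h
    rcases le_total (u b) m with h1 | h1
    · exact ⟨b, by omega, by omega, h1, h⟩
    · obtain ⟨j, h2, h3, h4⟩ := ih h1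
      exact ⟨j, h2, by omega, h4⟩

lemma sewing {T ε : ℝ} (hε : 0 < ε) {w : ℝ → ℝ → ℝ} {Z Y : ℝ → ℝ} (hc : PathControl T ε w Z Y)
    (u : ℕ → ℝ) : ∀ n a b : ℕ, b - a ≤ n → a ≤ b → 0 ≤ u a → u b ≤ T →
      (∀ i j, a ≤ i → i ≤ j → j ≤ b → u i ≤ u j) →
      |∑ i ∈ Finset.Ico a b, Z (u i) * (Y (u (i + 1)) - Y (u i)) - Z (u a) * (Y (u b) - Y (u a))|
        ≤ 2 / (1 - (1/2 : ℝ) ^ ε) * (w (u a) (u b) * (u b - u a) ^ ε) := by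
  obtain ⟨hw0, hwa, hZY⟩ := hc
  have hθ1 : (1/2 : ℝ) ^ ε < 1 := Real.rpow_lt_one (by norm_num) (by norm_num) hε
  have hθ0 : 0 < (1/2 : ℝ) ^ ε := Real.rpow_pos_of_pos (by norm_num) _
  set θ := (1/2 : ℝ) ^ ε with hθ
  set K := 2 / (1 - θ) with hK
  have hK0 : 0 ≤ K := div_nonneg (by norm_num) (by linarith)
  have hKeq : K * θ + 2 = K := by
    rw [hK]; have : (1 - θ) ≠ 0 := by linarith
    field_simp; ring
  intro n
  induction n with
  | zero =>
    intro a b h1 h2 h3 h4 hm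
    have : a = b := by omega
    subst this
    simp only [Finset.Ico_self, Finset.sum_empty, sub_self, mul_zero, abs_zero]
    have := hw0 (u a) (u a) h3 le_rfl h4
    positivity
  | succ n ih =>
    intro a b h1 h2 h3 h4 hm
    rcases h2.eq_or_lt with h5 | h5
    · subst h5
      exact ih a a (by omega) le_rfl h3 h4 hm
    have hab := hm a b le_rfl h2 le_rfl
    obtain ⟨j, hj1, hj2, hj3, hj4⟩ := exists_split u a ((u a + u b) / 2) (by linarith) b h5
      (by linarith)
    have e1 := hm a j le_rfl hj1 hj2.le
    have e2 := hm j (j+1) hj1 (by omega) hj2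
    have e3 := hm (j+1) b (by omega) hj2 le_rfl
    have i1 := ih a j (by omega) hj1 h3 (by linarith)
      (fun i k hi hk hl => hm i k hi hk (by omega))
    have i2 := ih (j+1) b (by omega) hj2 (by linarith) h4
      (fun i k hi hk hl => hm i k (by omega) hk hl)
    have hsum : ∑ i ∈ Finset.Ico a b, Z (u i) * (Y (u (i + 1)) - Y (u i))
        = ∑ i ∈ Finset.Ico a j, Z (u i) * (Y (u (i + 1)) - Y (u i))
        + Z (u j) * (Y (u (j + 1)) - Y (u j))
        + ∑ i ∈ Finset.Ico (j+1) b, Z (u i) * (Y (u (i + 1)) - Y (u i)) := by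
      rw [← Finset.sum_Ico_consecutive _ hj1 hj2.le, Finset.sum_eq_sum_Ico_succ_bot hj2]
      ring
    rw [hsum]
    set A := ∑ i ∈ Finset.Ico a j, Z (u i) * (Y (u (i + 1)) - Y (u i))
    set B := ∑ i ∈ Finset.Ico (j+1) b, Z (u i) * (Y (u (i + 1)) - Y (u i))
    have hθl : ∀ x, 0 ≤ x → x ≤ (u b - u a) / 2 → x ^ ε ≤ θ * (u b - u a) ^ ε := by
      intro x hx hx2
      rw [hθ, ← Real.mul_rpow (by norm_num) (by linarith)]
      exact Real.rpow_le_rpow hx (by linarith) hε.le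
    have f1 := hθl (u j - u a) (by linarith) (by linarith)
    have f2 := hθl (u b - u (j+1)) (by linarith) (by linarith)
    have w1 := hw0 (u a) (u j) h3 e1 (by linarith)
    have w2 := hw0 (u (j+1)) (u b) (by linarith) e3 h4
    have w3 := hw0 (u j) (u (j+1)) (by linarith) e2 (by linarith)
    have w4 := hwa (u a) (u j) (u b) h3 e1 (by linarith) h4
    have w5 := hwa (u j) (u (j+1)) (u b) (by linarith) e2 (by linarith) h4
    have g1 := hZY (u a) (u b) h3 hab h4 (u j) ⟨by linarith, by linarith⟩ (u a)
      ⟨by linarith, by linarith⟩ (u (j+1)) ⟨by linarith, by linarith⟩ (u j)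
      ⟨by linarith, by linarith⟩
    have g2 := hZY (u a) (u b) h3 hab h4 (u (j+1)) ⟨by linarith, by linarith⟩ (u a)
      ⟨by linarith, by linarith⟩ (u b) ⟨by linarith, by linarith⟩ (u (j+1))
      ⟨by linarith, by linarith⟩
    rw [← abs_mul] at g1 g2
    set L := (u b - u a) ^ ε
    have hL : 0 ≤ L := Real.rpow_nonneg (by linarith) _
    have k1 : w (u a) (u j) * (u j - u a) ^ ε ≤ w (u a) (u j) * (θ * L) :=
      mul_le_mul_of_nonneg_left f1 w1
    have k2 : w (u (j+1)) (u b) * (u b - u (j+1)) ^ ε ≤ w (u (j+1)) (u b) * (θ * L) :=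
      mul_le_mul_of_nonneg_left f2 w2
    have k3 : (w (u a) (u j) + w (u (j+1)) (u b)) * (θ * L) ≤ w (u a) (u b) * (θ * L) :=
      mul_le_mul_of_nonneg_right (by linarith) (by positivity)
    have k4 : K * (w (u a) (u j) * (u j - u a) ^ ε) + K * (w (u (j+1)) (u b) * (u b - u (j+1)) ^ ε)
        ≤ K * (w (u a) (u b) * (θ * L)) := by
      rw [← mul_add]
      exact mul_le_mul_of_nonneg_left (by linarith) hK0
    have k5 : K * (w (u a) (u b) * (θ * L)) + 2 * (w (u a) (u b) * L) = K * (w (u a) (u b) * L) := by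
      calc _ = (K * θ + 2) * (w (u a) (u b) * L) := by ring
        _ = _ := by rw [hKeq]
    rw [← k5]
    have hdec : A + Z (u j) * (Y (u (j + 1)) - Y (u j)) + B - Z (u a) * (Y (u b) - Y (u a))
      = (A - Z (u a) * (Y (u j) - Y (u a))) + (B - Z (u (j+1)) * (Y (u b) - Y (u (j+1))))
        + (Z (u j) - Z (u a)) * (Y (u (j+1)) - Y (u j))
        + (Z (u (j+1)) - Z (u a)) * (Y (u b) - Y (u (j+1))) := by ring
    rw [hdec]
    refine (abs_add_le _ _).trans ?_
    have := abs_add_le ((A - Z (u a) * (Y (u j) - Y (u a))) + (B - Z (u (j+1)) * (Y (u b) - Y (u (j+1))))) ((Z (u j) - Z (u a)) * (Y (u (j+1)) - Y (u j)))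
    have := abs_add_le (A - Z (u a) * (Y (u j) - Y (u a))) (B - Z (u (j+1)) * (Y (u b) - Y (u (j+1))))
    linarith

lemma TaggedPartition.t_mono {T : ℝ} (π : TaggedPartition T) {i j : ℕ} (hij : i ≤ j)
    (hj : j ≤ π.k) : π.t i ≤ π.t j := by
  induction j, hij using Nat.le_induction with
  | base => exact le_rfl
  | succ b hb ih => exact (ih (by omega)).trans (π.mono b (by omega)).le

lemma TaggedPartition.le_mesh {T : ℝ} (π : TaggedPartition T) {i : ℕ} (hi : i < π.k) :
    π.t (i+1) - π.t i ≤ π.mesh :=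
  Finset.le_sup' (fun i => π.t (i + 1) - π.t i) (Finset.mem_range.mpr hi)

lemma TaggedPartition.mesh_nonneg {T : ℝ} (π : TaggedPartition T) : 0 ≤ π.mesh :=
  (sub_nonneg.2 (π.mono 0 π.hk).le).trans (π.le_mesh π.hk)

lemma TaggedPartition.t_nonneg {T : ℝ} (π : TaggedPartition T) {i : ℕ} (hi : i ≤ π.k) :
    0 ≤ π.t i := by
  rw [← π.h0]; exact π.t_mono (Nat.zero_le _) hi

lemma TaggedPartition.t_le_s4 {T : ℝ} (π : TaggedPartition T) {i : ℕ} (hi : i ≤ π.k) :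
    π.t i ≤ T := by
  conv_rhs => rw [← π.hT]
  exact π.t_mono hi le_rfl

/-- Summing the local bounds along a partition. -/
lemma TaggedPartition.sum_control {T ε : ℝ} (π : TaggedPartition T) (hε : 0 < ε)
    {w : ℝ → ℝ → ℝ} {Z Y : ℝ → ℝ} (hc : PathControl T ε w Z Y) :
    ∑ i ∈ Finset.range π.k, w (π.t i) (π.t (i+1)) * (π.t (i+1) - π.t i) ^ ε
      ≤ w 0 T * π.mesh ^ ε := by
  have h1 : ∀ n ≤ π.k, ∑ i ∈ Finset.range n, w (π.t i) (π.t (i+1)) ≤ w 0 (π.t n) := by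
    intro n
    induction n with
    | zero => intro _; simpa [π.h0] using hc.1 0 0 le_rfl le_rfl ((π.t_nonneg le_rfl).trans (π.t_le_s4 le_rfl))
    | succ n ih =>
      intro hn
      rw [Finset.sum_range_succ]
      have := hc.2.1 0 (π.t n) (π.t (n+1)) le_rfl (π.t_nonneg (by omega)) (π.mono n hn).le (π.t_le_s4 hn)
      linarith [ih (by omega)]
  have h2 := h1 π.k le_rfl
  rw [π.hT] at h2
  calc _ ≤ ∑ i ∈ Finset.range π.k, w (π.t i) (π.t (i+1)) * π.mesh ^ ε := by
        refine Finset.sum_le_sum fun i hi => ?_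
        have hi := Finset.mem_range.1 hi
        refine mul_le_mul_of_nonneg_left (Real.rpow_le_rpow ?_ (π.le_mesh hi) hε.le)
          (hc.1 _ _ (π.t_nonneg hi.le) (π.mono i hi).le (π.t_le_s4 hi))
        linarith [π.mono i hi]
    _ = (∑ i ∈ Finset.range π.k, w (π.t i) (π.t (i+1))) * π.mesh ^ ε := by rw [Finset.sum_mul]
    _ ≤ _ := mul_le_mul_of_nonneg_right h2 (Real.rpow_nonneg π.mesh_nonneg _)

def TaggedPartition.lSum {T : ℝ} (π : TaggedPartition T) (Z Y : ℝ → ℝ) : ℝ :=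
  ∑ i ∈ Finset.range π.k, Z (π.t i) * (Y (π.t (i + 1)) - Y (π.t i))

lemma TaggedPartition.abs_rsSum_sub {T ε : ℝ} (π : TaggedPartition T) (hε : 0 < ε)
    {w : ℝ → ℝ → ℝ} {Z Y : ℝ → ℝ} (hc : PathControl T ε w Z Y) :
    |π.rsSum Z Y - π.lSum Z Y| ≤ w 0 T * π.mesh ^ ε := by
  refine le_trans ?_ (π.sum_control hε hc)
  rw [rsSum, lSum, ← Finset.sum_sub_distrib]
  refine (Finset.abs_sum_le_sum_abs _ _).trans (Finset.sum_le_sum fun i hi => ?_)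
  have hi := Finset.mem_range.1 hi
  have hm := π.mono i hi
  rw [← sub_mul, abs_mul]
  exact hc.2.2 _ _ (π.t_nonneg hi.le) hm.le (π.t_le_s4 hi) _ (π.tagmem i hi) _
    ⟨le_rfl, hm.le⟩ _ ⟨hm.le, le_rfl⟩ _ ⟨le_rfl, hm.le⟩

lemma TaggedPartition.abs_rsSum_swap {T ε : ℝ} (π : TaggedPartition T) (hε : 0 < ε)
    {w : ℝ → ℝ → ℝ} {Z Y : ℝ → ℝ} (hc : PathControl T ε w Z Y) :
    |π.rsSum Y Z - (Z T * Y T - Z 0 * Y 0 - π.lSum Z Y)| ≤ w 0 T * π.mesh ^ ε := by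
  refine le_trans ?_ (π.sum_control hε hc)
  have h1 : Z T * Y T - Z 0 * Y 0 =
      ∑ i ∈ Finset.range π.k, (Z (π.t (i+1)) * Y (π.t (i+1)) - Z (π.t i) * Y (π.t i)) := by
    rw [Finset.sum_range_sub (fun i => Z (π.t i) * Y (π.t i)), π.h0, π.hT]
  rw [h1, rsSum, lSum, ← Finset.sum_sub_distrib, ← Finset.sum_sub_distrib]
  refine (Finset.abs_sum_le_sum_abs _ _).trans (Finset.sum_le_sum fun i hi => ?_)
  have hi := Finset.mem_range.1 hi
  have hm := π.mono i hi
  have : Y (π.tag i) * (Z (π.t (i + 1)) - Z (π.t i)) -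
      (Z (π.t (i + 1)) * Y (π.t (i + 1)) - Z (π.t i) * Y (π.t i) -
        Z (π.t i) * (Y (π.t (i + 1)) - Y (π.t i)))
      = (Z (π.t (i+1)) - Z (π.t i)) * (Y (π.tag i) - Y (π.t (i+1))) := by ring
  rw [this, abs_mul]
  exact hc.2.2 _ _ (π.t_nonneg hi.le) hm.le (π.t_le_s4 hi) _ ⟨hm.le, le_rfl⟩ _ 
    ⟨le_rfl, hm.le⟩ _ (π.tagmem i hi) _ ⟨hm.le, le_rfl⟩

/-- Comparison with a refinement. -/
lemma TaggedPartition.abs_lSum_refine {T ε : ℝ} (π : TaggedPartition T) (hε : 0 < ε)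
    {w : ℝ → ℝ → ℝ} {Z Y : ℝ → ℝ} (hc : PathControl T ε w Z Y) (v : ℕ → ℝ) (φ : ℕ → ℕ)
    (hφ : ∀ i ≤ π.k, v (φ i) = π.t i) (hφm : ∀ i < π.k, φ i ≤ φ (i+1))
    (hv : ∀ i j, i ≤ j → j ≤ φ π.k → v i ≤ v j) :
    |∑ i ∈ Finset.Ico (φ 0) (φ π.k), Z (v i) * (Y (v (i + 1)) - Y (v i)) - π.lSum Z Y|
      ≤ 2 / (1 - (1/2 : ℝ) ^ ε) * (w 0 T * π.mesh ^ ε) := by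
  have hmono : ∀ i j, i ≤ j → j ≤ π.k → φ i ≤ φ j := by
    intro i j hij
    induction j, hij using Nat.le_induction with
    | base => intro _; exact le_rfl
    | succ b hb ih => intro hb2; exact (ih (by omega)).trans (hφm b (by omega))
  have hs : ∀ n ≤ π.k, ∑ i ∈ Finset.Ico (φ 0) (φ n), Z (v i) * (Y (v (i + 1)) - Y (v i))
      = ∑ m ∈ Finset.range n, ∑ i ∈ Finset.Ico (φ m) (φ (m+1)),
        Z (v i) * (Y (v (i + 1)) - Y (v i)) := by
    intro n
    induction n with
    | zero => intro _; simp
    | succ n ih =>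
      intro hn
      rw [Finset.sum_range_succ, ← ih (by omega),
        Finset.sum_Ico_consecutive _ (hmono 0 n (by omega) (by omega)) (hφm n hn)]
  have hθ1 : (1/2 : ℝ) ^ ε < 1 := Real.rpow_lt_one (by norm_num) (by norm_num) hε
  have hK0 : 0 ≤ 2 / (1 - (1/2 : ℝ) ^ ε) := div_nonneg (by norm_num) (by linarith)
  refine le_trans ?_ (mul_le_mul_of_nonneg_left (π.sum_control hε hc) hK0)
  rw [hs _ le_rfl, lSum, ← Finset.sum_sub_distrib, Finset.mul_sum]
  refine (Finset.abs_sum_le_sum_abs _ _).trans (Finset.sum_le_sum fun i hi => ?_)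
  have hi := Finset.mem_range.1 hi
  have := sewing hε hc v _ (φ i) (φ (i+1)) le_rfl (hφm i hi)
    (by rw [hφ i hi.le]; exact π.t_nonneg hi.le) (by rw [hφ _ hi]; exact π.t_le_s4 hi)
    (fun a b _ h2 h3 => hv a b h2 (h3.trans (hmono _ _ hi le_rfl)))
  rwa [hφ i hi.le, hφ _ hi] at this

lemma TaggedPartition.abs_lSum_sub {T ε : ℝ} (π π' : TaggedPartition T) (hε : 0 < ε)
    {w : ℝ → ℝ → ℝ} {Z Y : ℝ → ℝ} (hc : PathControl T ε w Z Y) :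
    |π.lSum Z Y - π'.lSum Z Y| ≤ 2 / (1 - (1/2 : ℝ) ^ ε) * (w 0 T * π.mesh ^ ε)
      + 2 / (1 - (1/2 : ℝ) ^ ε) * (w 0 T * π'.mesh ^ ε) := by
  classical
  set F : Finset ℝ := (Finset.range (π.k+1)).image π.t ∪ (Finset.range (π'.k+1)).image π'.t with hF
  set e := F.orderEmbOfFin rfl with he
  have hmem : ∀ x ∈ F, ∃ j, e j = x := by
    intro x hx
    have : x ∈ Set.range e := by rw [he, Finset.range_orderEmbOfFin]; exact hx
    exact this
  let v : ℕ → ℝ := fun j => if hj : j < F.card then e ⟨j, hj⟩ else 0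
  have hve : ∀ j : Fin F.card, v j = e j := by
    intro j; simp [v]
  have hvm : ∀ i j, i ≤ j → j < F.card → v i ≤ v j := by
    intro i j hij hj
    simp only [v, hj, hij.trans_lt hj, dif_pos]
    exact e.monotone hij
  have key : ∀ ρ : TaggedPartition T, (∀ i ≤ ρ.k, ρ.t i ∈ F) → ∃ φ : ℕ → Fin F.card,
      ∀ i ≤ ρ.k, e (φ i) = ρ.t i := by
    intro ρ hρ
    obtain ⟨j0, _⟩ := hmem _ (hρ 0 (Nat.zero_le _))
    refine ⟨fun i => if hi : i ≤ ρ.k then (hmem _ (hρ i hi)).choose else j0, fun i hi => ?_⟩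
    simp only [hi, dif_pos]
    exact (hmem _ (hρ i hi)).choose_spec
  have fin : ∀ ρ : TaggedPartition T, ∀ φ : ℕ → Fin F.card, (∀ i ≤ ρ.k, e (φ i) = ρ.t i) →
      |∑ i ∈ Finset.Ico (φ 0 : ℕ) (φ ρ.k), Z (v i) * (Y (v (i + 1)) - Y (v i)) - ρ.lSum Z Y|
      ≤ 2 / (1 - (1/2 : ℝ) ^ ε) * (w 0 T * ρ.mesh ^ ε) := by
    intro ρ φ hφ
    refine ρ.abs_lSum_refine hε hc v (fun i => (φ i : ℕ)) (fun i hi => by rw [hve, hφ i hi]) ?_ ?_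
    · intro i hi
      have : e (φ i) ≤ e (φ (i+1)) := by rw [hφ i hi.le, hφ _ hi]; exact (ρ.mono i hi).le
      exact e.le_iff_le.1 this
    · intro i j hij hj
      exact hvm i j hij (hj.trans_lt (φ ρ.k).2)
  obtain ⟨φ, hφ⟩ := key π (fun i hi => Finset.mem_union_left _
    (Finset.mem_image_of_mem _ (Finset.mem_range.2 (by omega))))
  obtain ⟨φ', hφ'⟩ := key π' (fun i hi => Finset.mem_union_right _
    (Finset.mem_image_of_mem _ (Finset.mem_range.2 (by omega))))
  have h0 : φ 0 = φ' 0 := e.injective (by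
    rw [hφ 0 (Nat.zero_le _), hφ' 0 (Nat.zero_le _), π.h0, π'.h0])
  have h1 : φ π.k = φ' π'.k := e.injective (by
    rw [hφ _ le_rfl, hφ' _ le_rfl, π.hT, π'.hT])
  have a1 := fin π φ hφ
  have a2 := fin π' φ' hφ'
  rw [h0, h1] at a1
  rw [abs_sub_comm] at a1
  exact (abs_sub_le _ _ _).trans (add_le_add a1 a2)

lemma pathwise_s4 {T ε : ℝ} (hε : 0 < ε) {w : ℝ → ℝ → ℝ} {Z Y : ℝ → ℝ}
    (hc : PathControl T ε w Z Y) :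
    ∃ I : ℝ, ∀ π : ℕ → TaggedPartition T, Tendsto (fun n => (π n).mesh) atTop (nhds 0) →
      Tendsto (fun n => (π n).rsSum Z Y) atTop (nhds I) ∧
      Tendsto (fun n => (π n).rsSum Y Z) atTop (nhds (Z T * Y T - Z 0 * Y 0 - I)) := by
  set K := 2 / (1 - (1/2 : ℝ) ^ ε) with hK
  have hz : ∀ (c : ℝ) (π : ℕ → TaggedPartition T), Tendsto (fun n => (π n).mesh) atTop (nhds 0) →
      Tendsto (fun n => c * (w 0 T * (π n).mesh ^ ε)) atTop (nhds 0) := by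
    intro c π hπ
    have := ((hπ.rpow_const (p := ε) (Or.inr hε.le)).const_mul (w 0 T)).const_mul c
    simpa [Real.zero_rpow hε.ne'] using this
  by_cases hex : ∃ π : ℕ → TaggedPartition T, Tendsto (fun n => (π n).mesh) atTop (nhds 0)
  swap
  · exact ⟨0, fun π hπ => absurd ⟨π, hπ⟩ hex⟩
  obtain ⟨ρ, hρ⟩ := hex
  have hcau : CauchySeq (fun n => (ρ n).lSum Z Y) := by
    rw [Metric.cauchySeq_iff']
    intro δ hδ
    obtain ⟨N, hN⟩ := eventually_atTop.1 ((hz K ρ hρ).eventually (gt_mem_nhds (half_pos hδ)))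
    refine ⟨N, fun n hn => ?_⟩
    rw [Real.dist_eq]
    have := (ρ n).abs_lSum_sub (ρ N) hε hc
    linarith [hN n hn, hN N le_rfl]
  obtain ⟨I, hI⟩ := cauchySeq_tendsto_of_complete hcau
  refine ⟨I, fun π hπ => ?_⟩
  have hl : Tendsto (fun n => (π n).lSum Z Y) atTop (nhds I) := by
    have h1 : Tendsto (fun n => (π n).lSum Z Y - (ρ n).lSum Z Y) atTop (nhds 0) := by
      refine squeeze_zero_norm (fun n => (π n).abs_lSum_sub (ρ n) hε hc) ?_
      have h2 := (hz K π hπ).add (hz K ρ hρ)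
      rw [add_zero] at h2
      exact h2
    simpa using h1.add hI
  have hz1 : Tendsto (fun n => w 0 T * (π n).mesh ^ ε) atTop (nhds 0) := by
    simpa using hz 1 π hπ
  constructor
  · have h1 : Tendsto (fun n => (π n).rsSum Z Y - (π n).lSum Z Y) atTop (nhds 0) :=
      squeeze_zero_norm (fun n => (π n).abs_rsSum_sub hε hc) hz1
    simpa using h1.add hl
  · have h1 : Tendsto (fun n => (π n).rsSum Y Z - (Z T * Y T - Z 0 * Y 0 - (π n).lSum Z Y))
        atTop (nhds 0) :=
      squeeze_zero_norm (fun n => (π n).abs_rsSum_swap hε hc) hz1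
    simpa using h1.add (hl.const_sub (Z T * Y T - Z 0 * Y 0))

/-- Truncated oscillation kernel. -/
def oscKernel (V : ℝ → ℝ) (N r x : ℝ) : ℝ≥0∞ :=
  (Icc (-N) N).indicator (fun x => ENNReal.ofReal (V (x + N * r) - V (x - N * r))) x

lemma measurable_oscKernel {V : ℝ → ℝ} (hV : Monotone V) (N r : ℝ) :
    Measurable (oscKernel V N r) := by
  have hm := hV.measurable
  unfold oscKernel
  exact Measurable.indicator (by fun_prop) measurableSet_Icc

lemma lintegral_oscKernel {V : ℝ → ℝ} (hV : Monotone V) {N r : ℝ} (hN : 0 ≤ N) (hr : 0 ≤ r) :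
    ∫⁻ x, oscKernel V N r x ≤ ENNReal.ofReal (2 * (N * r) * (V (N + N * r) - V (-N - N * r))) := by
  unfold oscKernel
  set ρ := N * r with hρ
  have hρ0 : 0 ≤ ρ := mul_nonneg hN hr
  rw [lintegral_indicator measurableSet_Icc]
  have hint : ∀ a b : ℝ, IntervalIntegrable V volume a b := fun a b =>
    (hV.monotoneOn _).intervalIntegrable
  have hmp : Monotone (fun x => V (x + ρ)) := fun a b hab => hV (by linarith)
  have hmm : Monotone (fun x => V (x - ρ)) := fun a b hab => hV (by linarith)
  have hip : IntervalIntegrable (fun x => V (x + ρ)) volume (-N) N :=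
    (hmp.monotoneOn _).intervalIntegrable
  have him : IntervalIntegrable (fun x => V (x - ρ)) volume (-N) N :=
    (hmm.monotoneOn _).intervalIntegrable
  have hii := hip.sub him
  rw [intervalIntegrable_iff_integrableOn_Icc_of_le (by linarith)] at hii
  rw [← ofReal_integral_eq_lintegral_ofReal hii
    (Eventually.of_forall fun x => sub_nonneg.2 (hV (by linarith)))]
  refine ENNReal.ofReal_le_ofReal ?_
  rw [integral_Icc_eq_integral_Ioc, ← intervalIntegral.integral_of_le (by linarith)]
  have e0 : ∫ x in (-N)..N, ((fun x => V (x + ρ)) - fun x => V (x - ρ)) x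
      = (∫ x in (-N)..N, V (x + ρ)) - ∫ x in (-N)..N, V (x - ρ) :=
    intervalIntegral.integral_sub hip him
  refine e0.le.trans ?_
  rw [intervalIntegral.integral_comp_add_right, intervalIntegral.integral_comp_sub_right]
  have e1 := intervalIntegral.integral_add_adjacent_intervals (hint (-N - ρ) (-N + ρ)) (hint (-N + ρ) (N + ρ))
  have e2 := intervalIntegral.integral_add_adjacent_intervals (hint (-N - ρ) (N - ρ)) (hint (N - ρ) (N + ρ))
  have b1 : ∫ x in (N - ρ)..(N + ρ), V x ≤ 2 * ρ * V (N + ρ) := by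
    have := intervalIntegral.integral_mono_on (a := N - ρ) (b := N + ρ) (f := V) (g := fun _ => V (N + ρ)) (by linarith) (hint _ _)
      (by simp) (fun x hx => hV hx.2)
    rw [intervalIntegral.integral_const, smul_eq_mul] at this
    linarith
  have b2 : 2 * ρ * V (-N - ρ) ≤ ∫ x in (-N - ρ)..(-N + ρ), V x := by
    have := intervalIntegral.integral_mono_on (a := -N - ρ) (b := -N + ρ) (g := V) (f := fun _ => V (-N - ρ)) (by linarith)
      (by simp) (hint _ _) (fun x hx => hV hx.1)
    rw [intervalIntegral.integral_const, smul_eq_mul] at this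
    linarith
  linarith

lemma ae_osc_finite {Ω : Type*} [MeasurableSpace Ω] (P : Measure Ω) [IsProbabilityMeasure P]
    {T : ℝ} {X : ℝ → Ω → ℝ} (hX : Measurable (Function.uncurry X))
    {g : ℝ → ℝ} (hgL1 : IntegrableOn g (Set.Icc 0 T))
    (hdens : BoundedDensityAssumption P T X g) {V : ℝ → ℝ} (hV : Monotone V)
    (a r : ℕ → ℝ) (ha : ∀ k, 0 ≤ a k) (hr : ∀ k, 0 ≤ r k) (hr1 : ∀ k, r k ≤ r 0)
    (hs : Summable fun k => a k * r k) {N : ℝ} (hN : 0 ≤ N) :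
    ∀ᵐ ω ∂P, ∫⁻ t in Icc 0 T, ∑' k, ENNReal.ofReal (a k) * oscKernel V N (r k) (X t ω) < ∞ := by
  have hmk : ∀ k, Measurable (fun p : ℝ × Ω => ENNReal.ofReal (a k) * oscKernel V N (r k) (X p.1 p.2)) :=
    fun k => ((measurable_oscKernel hV N (r k)).comp hX).const_mul _
  have hm : Measurable (fun p : ℝ × Ω => ∑' k, ENNReal.ofReal (a k) * oscKernel V N (r k) (X p.1 p.2)) :=
    Measurable.ennreal_tsum hmk
  refine ae_lt_top hm.lintegral_prod_left' ?_
  rw [lintegral_lintegral_swap (f := fun ω t => ∑' k, ENNReal.ofReal (a k) * oscKernel V N (r k) (X t ω))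
    (hm.comp measurable_swap).aemeasurable]
  set D := V (N + N * r 0) - V (-N - N * r 0) with hD
  have hb : ∀ᵐ t ∂(volume.restrict (Set.Icc (0:ℝ) T)),
      ∫⁻ ω, ∑' k, ENNReal.ofReal (a k) * oscKernel V N (r k) (X t ω) ∂P
        ≤ ENNReal.ofReal (g t) * ENNReal.ofReal (∑' k, 2 * N * D * (a k * r k)) := by
    filter_upwards [hdens] with t ht
    have hXt : Measurable (X t) := hX.comp measurable_prodMk_left
    have hmeas : P.map (X t) ≤ ENNReal.ofReal (g t) • volume := by
      refine Measure.le_iff.2 fun A hA => ?_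
      rw [Measure.map_apply hXt hA]
      exact ht A hA
    have hD0 : 0 ≤ D := sub_nonneg.2 (hV (by nlinarith [hr 0]))
    rw [lintegral_tsum (f := fun k ω => ENNReal.ofReal (a k) * oscKernel V N (r k) (X t ω))
        (fun k => ((hmk k).comp measurable_prodMk_left).aemeasurable),
      ENNReal.ofReal_tsum_of_nonneg (fun k => by have := ha k; have := hr k; positivity)
        (hs.mul_left _), ← ENNReal.tsum_mul_left]
    refine ENNReal.tsum_le_tsum fun k => ?_
    have hk := measurable_oscKernel hV N (r k)
    rw [lintegral_const_mul' _ _ ENNReal.ofReal_ne_top, ← lintegral_map hk hXt]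
    calc ENNReal.ofReal (a k) * ∫⁻ x, oscKernel V N (r k) x ∂(P.map (X t))
        ≤ ENNReal.ofReal (a k) * ∫⁻ x, oscKernel V N (r k) x ∂(ENNReal.ofReal (g t) • volume) := by
          gcongr
      _ = ENNReal.ofReal (g t) * (ENNReal.ofReal (a k) * ∫⁻ x, oscKernel V N (r k) x) := by
          rw [lintegral_smul_measure, smul_eq_mul]; ring
      _ ≤ ENNReal.ofReal (g t) * (ENNReal.ofReal (a k) * ENNReal.ofReal (2 * (N * r k) * D)) := by
          gcongr
          refine (lintegral_oscKernel hV hN (hr k)).trans (ENNReal.ofReal_le_ofReal ?_)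
          have hle : N * r k ≤ N * r 0 := mul_le_mul_of_nonneg_left (hr1 k) hN
          have h1 : V (N + N * r k) ≤ V (N + N * r 0) := hV (by linarith)
          have h2 : V (-N - N * r 0) ≤ V (-N - N * r k) := hV (by linarith)
          have := hr k
          exact mul_le_mul_of_nonneg_left (by linarith) (by positivity)
      _ = ENNReal.ofReal (g t) * ENNReal.ofReal (2 * N * D * (a k * r k)) := by
          rw [← ENNReal.ofReal_mul (ha k)]
          congr 2; ring
  refine ((lintegral_mono_ae hb).trans_lt ?_).ne
  rw [lintegral_mul_const' _ _ ENNReal.ofReal_ne_top]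
  refine ENNReal.mul_lt_top ?_ ENNReal.ofReal_lt_top
  exact (lintegral_ofReal_le_lintegral_enorm g).trans_lt hgL1.2

lemma path_control {T α γ ε : ℝ} (hT : 0 < T) (hα : 0 < α) (hγ' : γ - ε < 1)
    {x y h V : ℝ → ℝ} (hV : Monotone V) (hhV : ∀ p q, p ≤ q → |h q - h p| ≤ V q - V p)
    {N C : ℝ} (hN : 0 ≤ N)
    (hx : ∀ s ∈ Icc (0:ℝ) T, ∀ t ∈ Icc (0:ℝ) T, |x t - x s| ≤ N * |t - s| ^ α)
    (hxb : ∀ t ∈ Icc (0:ℝ) T, |x t| ≤ N)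
    (hC : 0 ≤ C) (hy : ∀ s ∈ Icc (0:ℝ) T, ∀ t ∈ Icc (0:ℝ) T, |y t - y s| ≤ C * |t - s| ^ γ)
    (hγ : 0 < γ)
    (hfin : ∫⁻ t in Icc 0 T, ∑' k : ℕ, ENNReal.ofReal ((T * (1/2) ^ (k+1)) ^ (γ - ε - 1)) *
      oscKernel V N ((T * (1/2) ^ k) ^ α) (x t) < ∞) :
    ∃ w, PathControl T ε w (fun u => h (x u)) y := by
  set G : ℝ → ℝ≥0∞ := fun t => ∑' k : ℕ, ENNReal.ofReal ((T * (1/2) ^ (k+1)) ^ (γ - ε - 1)) *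
      oscKernel V N ((T * (1/2) ^ k) ^ α) (x t) with hG
  have hft : ∀ s t, 0 ≤ s → t ≤ T → ∫⁻ u in Ioc s t, G u ≠ ∞ := by
    intro s t hs ht
    refine ((lintegral_mono_set ?_).trans_lt hfin).ne
    exact Ioc_subset_Icc_self.trans (Icc_subset_Icc hs ht)
  refine ⟨fun s t => C * (∫⁻ u in Ioc s t, G u).toReal, ?_, ?_, ?_⟩
  · intro s t _ _ _; positivity
  · intro s u t hs hsu hut ht
    rw [← mul_add, ← ENNReal.toReal_add (hft s u hs (hut.trans ht)) (hft u t (hs.trans hsu) ht),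
      ← lintegral_union measurableSet_Ioc (Ioc_disjoint_Ioc_of_le le_rfl),
      Ioc_union_Ioc_eq_Ioc hsu hut]
  · intro s t hs hst ht a ha b hb c hc d hd
    have hsub : ∀ u ∈ Icc s t, u ∈ Icc 0 T := fun u hu => ⟨hs.trans hu.1, hu.2.trans ht⟩
    rcases hst.eq_or_lt with h1 | h1
    · subst h1
      have : a = b := by linarith [ha.1, ha.2, hb.1, hb.2]
      subst this
      simp only [sub_self, abs_zero, zero_mul]
      positivity
    set l := t - s with hl
    have hl0 : 0 < l := by linarith
    -- the scale
    obtain ⟨k, hk1, hk2⟩ : ∃ k : ℕ, (1/2 : ℝ) ^ (k+1) < l / T ∧ l / T ≤ (1/2) ^ k :=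
      exists_nat_pow_near_of_lt_one (div_pos hl0 hT) ((div_le_one hT).2 (by linarith))
        (by norm_num) (by norm_num)
    have hk1 : T * (1/2) ^ (k+1) < l := by rw [lt_div_iff₀ hT] at hk1; linarith
    have hk2 : l ≤ T * (1/2) ^ k := by rw [div_le_iff₀ hT] at hk2; linarith
    have hdist : ∀ u ∈ Icc s t, ∀ v ∈ Icc s t, |u - v| ≤ l := by
      intro u hu v hv
      rw [abs_le]; constructor <;> linarith [hu.1, hu.2, hv.1, hv.2]
    set R := (T * (1/2) ^ k) ^ α with hR
    have hxR : ∀ u ∈ Icc s t, ∀ v ∈ Icc s t, |x u - x v| ≤ N * R := by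
      intro u hu v hv
      refine (hx v (hsub v hv) u (hsub u hu)).trans (mul_le_mul_of_nonneg_left ?_ hN)
      exact Real.rpow_le_rpow (abs_nonneg _) ((hdist u hu v hv).trans hk2) hα.le
    have hosc : ∀ u ∈ Icc s t, ENNReal.ofReal |h (x a) - h (x b)| ≤ oscKernel V N R (x u) := by
      intro u hu
      rw [oscKernel, indicator_of_mem (show x u ∈ Icc (-N) N from abs_le.1 (hxb u (hsub u hu)))]
      refine ENNReal.ofReal_le_ofReal ?_
      have a1 := abs_le.1 (hxR a ha u hu)
      have b1 := abs_le.1 (hxR b hb u hu)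
      have ha1 : V (x a) ≤ V (x u + N * R) := hV (by linarith [a1.2])
      have ha2 : V (x u - N * R) ≤ V (x a) := hV (by linarith [a1.1])
      have hb1 : V (x b) ≤ V (x u + N * R) := hV (by linarith [b1.2])
      have hb2 : V (x u - N * R) ≤ V (x b) := hV (by linarith [b1.1])
      rcases le_total (x a) (x b) with hab | hab
      · rw [abs_sub_comm]; linarith [hhV _ _ hab]
      · linarith [hhV _ _ hab]
    set Δ := |h (x a) - h (x b)| with hΔ
    have hΔ0 : 0 ≤ Δ := abs_nonneg _
    have hA : 0 ≤ l ^ (γ - ε - 1) := Real.rpow_nonneg hl0.le _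
    have hI : ENNReal.ofReal (l ^ (γ - ε - 1) * Δ * l) ≤ ∫⁻ u in Ioc s t, G u := by
      calc ENNReal.ofReal (l ^ (γ - ε - 1) * Δ * l)
          = ∫⁻ u in Ioc s t, ENNReal.ofReal (l ^ (γ - ε - 1) * Δ) := by
            rw [setLIntegral_const, Real.volume_Ioc, ← ENNReal.ofReal_mul (by positivity)]
        _ ≤ _ := by
            refine setLIntegral_mono' measurableSet_Ioc fun u hu => ?_
            refine le_trans ?_ (ENNReal.le_tsum k)
            rw [ENNReal.ofReal_mul hA]
            refine mul_le_mul' (ENNReal.ofReal_le_ofReal ?_) (hosc u ⟨hu.1.le, hu.2⟩)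
            exact Real.rpow_le_rpow_of_nonpos (by positivity) hk1.le (by linarith)
    have hI2 : l ^ (γ - ε - 1) * Δ * l ≤ (∫⁻ u in Ioc s t, G u).toReal :=
      (ENNReal.ofReal_le_iff_le_toReal (hft s t hs ht)).1 hI
    have hyb : |y c - y d| ≤ C * l ^ γ := by
      refine (hy d (hsub d hd) c (hsub c hc)).trans (mul_le_mul_of_nonneg_left ?_ hC)
      exact Real.rpow_le_rpow (abs_nonneg _) (hdist c hc d hd) hγ.le
    have hpow : l ^ γ = l ^ (γ - ε - 1) * l * l ^ ε := by
      nth_rewrite 3 [← Real.rpow_one l]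
      rw [← Real.rpow_add hl0, ← Real.rpow_add hl0]; congr 1; ring
    calc Δ * |y c - y d| ≤ Δ * (C * l ^ γ) := mul_le_mul_of_nonneg_left hyb hΔ0
      _ = C * (l ^ (γ - ε - 1) * Δ * l) * l ^ ε := by rw [hpow]; ring
      _ ≤ C * (∫⁻ u in Ioc s t, G u).toReal * l ^ ε := by gcongr

/-- with `Z_t = h(X_t)`, both Riemann–Stieltjes sums
`Σ_i Z_{τ_i}(Y_{t_i} - Y_{t_{i-1}})` and `Σ_i Y_{τ_i}(Z_{t_i} - Z_{t_{i-1}})` converge almost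
surely along any sequence of tagged partitions with vanishing mesh, to random variables `I`
and `I'` respectively, and the integration-by-parts formula
`I = Z_T Y_T - Z_0 Y_0 - I'` holds almost surely. -/
theorem riemann_stieltjes_integration_by_parts
    {Ω : Type*} [MeasurableSpace Ω] (P : Measure Ω) [IsProbabilityMeasure P]
    (T α γ : ℝ) (hT : 0 < T) (hα : α ∈ Set.Ioo (0:ℝ) 1) (hγ : γ ∈ Set.Ioo (0:ℝ) 1)
    (hαγ : 1 < α + γ)
    (X : ℝ → Ω → ℝ) (hX : Measurable (Function.uncurry X))
    (hXHolder : ∀ᵐ ω ∂P, HolderOnIcc α T (fun t => X t ω))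
    (g : ℝ → ℝ) (hg0 : ∀ t, 0 ≤ g t) (hgL1 : IntegrableOn g (Set.Icc 0 T))
    (hdens : BoundedDensityAssumption P T X g)
    (h : ℝ → ℝ) (hlc : ∀ x : ℝ, ContinuousWithinAt h (Set.Iic x) x)
    (hbv : LocallyBoundedVariationOn h Set.univ)
    (Y : ℝ → Ω → ℝ) (hYHolder : ∀ᵐ ω ∂P, HolderOnIcc γ T (fun t => Y t ω)) :
    ∃ I I' : Ω → ℝ,
      (∀ π : ℕ → TaggedPartition T,
        Tendsto (fun n => (π n).mesh) atTop (nhds 0) →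
        ∀ᵐ ω ∂P,
          Tendsto (fun n => (π n).rsSum (fun u => h (X u ω)) (fun u => Y u ω))
            atTop (nhds (I ω)) ∧
          Tendsto (fun n => (π n).rsSum (fun u => Y u ω) (fun u => h (X u ω)))
            atTop (nhds (I' ω))) ∧
      (∀ᵐ ω ∂P, I ω = h (X T ω) * Y T ω - h (X 0 ω) * Y 0 ω - I' ω) := by
  set ε := (α + γ - 1) / 2 with hε
  have hε0 : 0 < ε := by rw [hε]; linarith
  obtain ⟨hα0, hα1⟩ := hα
  obtain ⟨hγ0, hγ1⟩ := hγ
  obtain ⟨p, q, hp, hq, hpq⟩ := hbv.exists_monotoneOn_sub_monotoneOn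
  rw [monotoneOn_univ] at hp hq
  have hV : Monotone (p + q) := hp.add hq
  have hhV : ∀ a b, a ≤ b → |h b - h a| ≤ (p + q) b - (p + q) a := by
    intro a b hab
    have h1 := hp hab
    have h2 := hq hab
    rw [hpq]
    simp only [Pi.sub_apply, Pi.add_apply]
    rw [abs_le]; constructor <;> linarith
  have hsum : Summable fun k : ℕ =>
      (T * (1/2 : ℝ) ^ (k+1)) ^ (γ - ε - 1) * (T * (1/2 : ℝ) ^ k) ^ α := by
    have hgeo : Summable fun k : ℕ => (((1/2 : ℝ) ^ (γ - ε - 1)) * T ^ ε) * ((1/2 : ℝ) ^ ε) ^ k :=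
      (summable_geometric_of_lt_one (by positivity)
        (Real.rpow_lt_one (by norm_num) (by norm_num) hε0)).mul_left _
    refine hgeo.congr fun k => ?_
    have hk : 0 < T * (1/2 : ℝ) ^ k := by positivity
    have e1 : T * (1/2 : ℝ) ^ (k+1) = (1/2) * (T * (1/2 : ℝ) ^ k) := by ring
    rw [e1, Real.mul_rpow (by norm_num) hk.le, mul_assoc, mul_assoc, ← Real.rpow_add hk]
    have e2 : γ - ε - 1 + α = ε := by rw [hε]; ring
    rw [e2, Real.mul_rpow hT.le (by positivity), ← Real.rpow_natCast, ← Real.rpow_natCast,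
      ← Real.rpow_mul (by norm_num), ← Real.rpow_mul (by norm_num), mul_comm ε]
  have hfin : ∀ᵐ ω ∂P, ∀ N : ℕ, ∫⁻ t in Icc 0 T, ∑' k : ℕ,
      ENNReal.ofReal ((T * (1/2) ^ (k+1)) ^ (γ - ε - 1)) *
      oscKernel (p + q) N ((T * (1/2) ^ k) ^ α) (X t ω) < ∞ := by
    rw [ae_all_iff]
    intro N
    refine ae_osc_finite P hX hgL1 hdens hV (fun k : ℕ => (T * (1/2 : ℝ) ^ (k+1)) ^ (γ - ε - 1))
      (fun k : ℕ => (T * (1/2 : ℝ) ^ k) ^ α) (fun k => by positivity) (fun k => by positivity) ?_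
      hsum (Nat.cast_nonneg N)
    intro k
    refine Real.rpow_le_rpow (by positivity) ?_ hα0.le
    refine mul_le_mul_of_nonneg_left ?_ hT.le
    rw [pow_zero]
    exact pow_le_one₀ (by norm_num) (by norm_num)
  have hae : ∀ᵐ ω ∂P, ∃ J : ℝ, ∀ π : ℕ → TaggedPartition T,
      Tendsto (fun n => (π n).mesh) atTop (nhds 0) →
      Tendsto (fun n => (π n).rsSum (fun u => h (X u ω)) (fun u => Y u ω)) atTop (nhds J) ∧
      Tendsto (fun n => (π n).rsSum (fun u => Y u ω) (fun u => h (X u ω))) atTop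
        (nhds (h (X T ω) * Y T ω - h (X 0 ω) * Y 0 ω - J)) := by
    filter_upwards [hXHolder, hYHolder, hfin] with ω hx hy hf
    obtain ⟨A, hA⟩ := hx
    obtain ⟨C, hC⟩ := hy
    obtain ⟨N, hN⟩ := exists_nat_ge (|X 0 ω| + |A| + |A| * T ^ α)
    have hAT : 0 ≤ |A| * T ^ α := by positivity
    have hNA : |A| ≤ N := by linarith [abs_nonneg (X 0 ω)]
    obtain ⟨w, hw⟩ := path_control (x := fun t => X t ω) (y := fun t => Y t ω) (C := |C|) hT hα0
      (by linarith : γ - ε < 1) hV hhV (Nat.cast_nonneg N)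
      (fun s hs t ht => (hA s hs t ht).trans (mul_le_mul_of_nonneg_right
        ((le_abs_self A).trans hNA) (by positivity)))
      (by
        intro t ht
        have h1 := hA 0 ⟨le_rfl, hT.le⟩ t ht
        have h2 : A * |t - 0| ^ α ≤ |A| * T ^ α := by
          refine mul_le_mul (le_abs_self A) ?_ (by positivity) (abs_nonneg _)
          refine Real.rpow_le_rpow (abs_nonneg _) ?_ hα0.le
          rw [sub_zero, abs_of_nonneg ht.1]; exact ht.2
        have h3 := abs_sub_abs_le_abs_sub (X t ω) (X 0 ω)
        have h4 := abs_nonneg A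
        simp only at h1 ⊢
        linarith)
      (abs_nonneg C)
      (fun s hs t ht => (hC s hs t ht).trans (mul_le_mul_of_nonneg_right (le_abs_self C)
        (by positivity))) hγ0 (hf N)
    exact pathwise_s4 hε0 hw
  classical
  refine ⟨fun ω => if hω : _ then Classical.choose (p := fun J : ℝ => ∀ π : ℕ → TaggedPartition T,
      Tendsto (fun n => (π n).mesh) atTop (nhds 0) →
      Tendsto (fun n => (π n).rsSum (fun u => h (X u ω)) (fun u => Y u ω)) atTop (nhds J) ∧
      Tendsto (fun n => (π n).rsSum (fun u => Y u ω) (fun u => h (X u ω))) atTop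
        (nhds (h (X T ω) * Y T ω - h (X 0 ω) * Y 0 ω - J))) hω else 0,
    fun ω => h (X T ω) * Y T ω - h (X 0 ω) * Y 0 ω - (if hω : _ then Classical.choose
      (p := fun J : ℝ => ∀ π : ℕ → TaggedPartition T,
      Tendsto (fun n => (π n).mesh) atTop (nhds 0) →
      Tendsto (fun n => (π n).rsSum (fun u => h (X u ω)) (fun u => Y u ω)) atTop (nhds J) ∧
      Tendsto (fun n => (π n).rsSum (fun u => Y u ω) (fun u => h (X u ω))) atTop
        (nhds (h (X T ω) * Y T ω - h (X 0 ω) * Y 0 ω - J))) hω else 0), ?_, ?_⟩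
  · intro π hπ
    filter_upwards [hae] with ω hω
    rw [dif_pos hω]
    exact Classical.choose_spec hω π hπ
  · exact Eventually.of_forall fun ω => (sub_sub_cancel _ _).symm

end
end
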